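/- If 𝔤 ≠ 𝔰𝔩(2), then the first adjoint cohomology H¹(𝔫;𝔫) = Der(𝔫)/ad(𝔫) has dimension 2n, and the classes of the derivations D₁,…,Dₙ, B₁,…,Bₙ form a basis of it. -/

import Mathlib

open scoped InnerProductSpace

/-- The combinatorial data attached to a simple finite-dimensional complex Lie algebra `𝔤`
of rank `n` with a fixed Cartan subalgebra and a fixed system of simple roots
`α₁, …, αₙ`: a reduced crystallographic *irreducible* root system `R` in a euclidean
space `V`, together with a base `simple : Fin n → V` (the simple roots) and the coordinate
functions `coord`, recording for each positive root `α = Σᵢ Aᵢ(α) αᵢ` the tuple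
`(A₁(α), …, Aₙ(α))` of its coordinates with respect to the simple roots. -/
structure RootSystemBase (n : ℕ) (V : Type*) [NormedAddCommGroup V]
    [InnerProductSpace ℝ V] : Type _ where
  /-- The (finite) set of roots. -/
  R : Finset V
  zero_not_mem : (0 : V) ∉ R
  span_eq_top : Submodule.span ℝ (R : Set V) = ⊤
  reduced : ∀ α ∈ R, ∀ c : ℝ, c • α ∈ R → c = 1 ∨ c = -1
  crystallographic : ∀ α ∈ R, ∀ β ∈ R, ∃ k : ℤ, (k : ℝ) = 2 * ⟪β, α⟫_ℝ / ⟪α, α⟫_ℝ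
  reflect_mem : ∀ α ∈ R, ∀ β ∈ R, β - (2 * ⟪β, α⟫_ℝ / ⟪α, α⟫_ℝ) • α ∈ R
  /-- irreducibility: `R` is not the union of two nonempty orthogonal subsets;
  equivalently `𝔤` is simple rather than merely semisimple. -/
  irreducible : ∀ S : Finset V, S ⊆ R → (∀ α ∈ S, ∀ β ∈ R, β ∉ S → ⟪α, β⟫_ℝ = 0) →
    S = ∅ ∨ S = R
  /-- The simple roots `α₁, …, αₙ`. -/
  simple : Fin n → V
  simple_mem : ∀ i, simple i ∈ R
  simple_linearIndependent : LinearIndependent ℝ simple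
  /-- `coord β i` is the coefficient `Aᵢ(β)` of `β` in the basis of simple roots. -/
  coord : V → Fin n → ℤ
  root_eq_sum : ∀ β ∈ R, β = ∑ i, (coord β i : ℝ) • simple i
  coord_sign : ∀ β ∈ R, (∀ i, 0 ≤ coord β i) ∨ (∀ i, coord β i ≤ 0)

namespace RootSystemBase

variable {n : ℕ} {V : Type*} [NormedAddCommGroup V] [InnerProductSpace ℝ V]
variable (Φ : RootSystemBase n V)

/-- `β` is a positive root. -/
def IsPos (β : V) : Prop := β ∈ Φ.R ∧ ∀ i, 0 ≤ Φ.coord β i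

/-- The level `l(β) = Σᵢ Aᵢ(β)` of a root `β`. -/
def level (β : V) : ℤ := ∑ i, Φ.coord β i

/-- `μ` is the highest root. -/
def IsHighest (μ : V) : Prop :=
  Φ.IsPos μ ∧ ∀ β, Φ.IsPos β → ∀ i, Φ.coord β i ≤ Φ.coord μ i

end RootSystemBase

/-- A linear map `T : 𝔫 → 𝔫` is a derivation of the Lie algebra `𝔫`. -/
def IsLieDerivation {L : Type*} [LieRing L] [LieAlgebra ℂ L] (T : Module.End ℂ L) : Prop :=
  ∀ x y : L, T ⁅x, y⁆ = ⁅T x, y⁆ + ⁅x, T y⁆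

attribute [local instance 100] LieRing.ofAssociativeRing

/-- The inner derivations `ad x`, `x ∈ 𝔫`, as a subspace of `End(𝔫)`. -/
noncomputable def innerDerivations (L : Type*) [LieRing L] [LieAlgebra ℂ L] :
    Submodule ℂ (Module.End ℂ L) :=
  LinearMap.range (LieAlgebra.ad ℂ L).toLinearMap

/-- The derivations of `𝔫`, as a subspace of `End(𝔫)`. -/
noncomputable def derivations (L : Type*) [LieRing L] [LieAlgebra ℂ L] :
    Submodule ℂ (Module.End ℂ L) where
  carrier := {T | IsLieDerivation T}
  add_mem' := by
    intro S T hS hT x y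
    simp only [LinearMap.add_apply, hS x y, hT x y, add_lie, lie_add]
    abel
  zero_mem' := by intro x y; simp
  smul_mem' := by
    intro c T hT x y
    simp only [LinearMap.smul_apply, hT x y, smul_lie, lie_smul, smul_add]

/-- A Chevalley-basis presentation of the maximal nilpotent subalgebra
`𝔫 = ⊕_{α ∈ R⁺} 𝔤_α` of a simple finite-dimensional complex Lie algebra `𝔤` with root
system `Φ`: a complex Lie algebra `𝔫` together with a basis `e` of root vectors indexed
by the positive roots, such that `⁅e_α, e_β⁆ = N_{αβ} • e_{α+β}` when `α+β ∈ R⁺` and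
`⁅e_α, e_β⁆ = 0` otherwise, where the structure constants `N_{αβ}` of the Chevalley basis
are nonzero whenever `α + β` is a root. -/
structure ChevalleyNilradical {n : ℕ} {V : Type*} [NormedAddCommGroup V]
    [InnerProductSpace ℝ V] (Φ : RootSystemBase n V)
    (L : Type*) [LieRing L] [LieAlgebra ℂ L] where
  /-- the root vectors `e_α`, `α ∈ R⁺`, a basis of `𝔫` -/
  e : Module.Basis {β : V // Φ.IsPos β} ℂ L
  /-- the structure constants -/
  N : V → V → ℂ
  lie_eq : ∀ (α β : {β : V // Φ.IsPos β}) (h : Φ.IsPos (α.1 + β.1)),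
    ⁅e α, e β⁆ = N α.1 β.1 • e ⟨α.1 + β.1, h⟩
  lie_eq_zero : ∀ α β : {β : V // Φ.IsPos β}, ¬ Φ.IsPos (α.1 + β.1) → ⁅e α, e β⁆ = 0
  N_ne_zero : ∀ α β : {β : V // Φ.IsPos β}, Φ.IsPos (α.1 + β.1) → N α.1 β.1 ≠ 0

namespace ChevalleyNilradical

variable {n : ℕ} {V : Type*} [NormedAddCommGroup V] [InnerProductSpace ℝ V]
  {Φ : RootSystemBase n V} {L : Type*} [LieRing L] [LieAlgebra ℂ L]
  (C : ChevalleyNilradical Φ L)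

/-- The weight-zero cocycle (derivation) `Dᵢ = cᵢ : e_α ↦ Aᵢ(α) e_α`. -/
noncomputable def D (i : Fin n) : Module.End ℂ L :=
  C.e.constr ℂ fun β => (Φ.coord β.1 i : ℂ) • C.e β

/-- The cocycle (derivation) `Bᵢ = bᵢ = e_{γᵢ} ⊗ f^{αᵢ}`, sending `e_{αᵢ} ↦ e_{γᵢ}` where
`γᵢ = μ − mᵢ αᵢ`, and killing `e_β` for every positive root `β ≠ αᵢ`. -/
noncomputable def B (μ : V) (m : Fin n → ℕ)
    (hγ : ∀ i, Φ.IsPos (μ - m i • Φ.simple i)) (i : Fin n) : Module.End ℂ L :=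
  letI := Classical.decEq V
  C.e.constr ℂ fun β => if β.1 = Φ.simple i then C.e ⟨μ - m i • Φ.simple i, hγ i⟩ else 0

end ChevalleyNilradical

namespace RootSystemBase

variable {n : ℕ} {V : Type*} [NormedAddCommGroup V] [InnerProductSpace ℝ V]
variable (Φ : RootSystemBase n V)

/-! ### Geometry of roots -/

lemma inner_self_pos_of_mem {α : V} (hα : α ∈ Φ.R) : 0 < ⟪α, α⟫_ℝ := by
  rw [real_inner_self_pos]
  rintro rfl
  exact Φ.zero_not_mem hα

/-- The Cartan integer of two roots. -/
lemma exists_cartan {α β : V} (hα : α ∈ Φ.R) (hβ : β ∈ Φ.R) :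
    ∃ k : ℤ, 2 * ⟪β, α⟫_ℝ = k * ⟪α, α⟫_ℝ ∧ β - (k : ℝ) • α ∈ Φ.R := by
  obtain ⟨k, hk⟩ := Φ.crystallographic α hα β hβ
  refine ⟨k, ?_, ?_⟩
  · rw [hk, div_mul_cancel₀ _ (Φ.inner_self_pos_of_mem hα).ne']
  · rw [hk]
    exact Φ.reflect_mem α hα β hβ

lemma reflect_mem_of_eq {α β : V} (hα : α ∈ Φ.R) (hβ : β ∈ Φ.R) {k : ℝ}
    (hk : 2 * ⟪β, α⟫_ℝ = k * ⟪α, α⟫_ℝ) : β - k • α ∈ Φ.R := by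
  have h := Φ.reflect_mem α hα β hβ
  rwa [hk, mul_div_cancel_right₀ _ (Φ.inner_self_pos_of_mem hα).ne'] at h

lemma neg_mem {α : V} (hα : α ∈ Φ.R) : -α ∈ Φ.R := by
  have h := Φ.reflect_mem_of_eq hα hα rfl
  rwa [two_smul, sub_add_cancel_left] at h

/-- The product of the two Cartan integers of a pair of roots is at most `4`. -/
lemma cartan_mul_le {α β : V} (hα : α ∈ Φ.R) (hβ : β ∈ Φ.R) {k l : ℤ}
    (hk : 2 * ⟪β, α⟫_ℝ = k * ⟪α, α⟫_ℝ) (hl : 2 * ⟪α, β⟫_ℝ = l * ⟪β, β⟫_ℝ) : k * l ≤ 4 := by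
  have h1 := Φ.inner_self_pos_of_mem hα
  have h2 := Φ.inner_self_pos_of_mem hβ
  have h := real_inner_mul_inner_self_le α β
  rw [real_inner_comm α β] at hk
  have : ((k * l : ℤ) : ℝ) * (⟪α, α⟫_ℝ * ⟪β, β⟫_ℝ) ≤ 4 * (⟪α, α⟫_ℝ * ⟪β, β⟫_ℝ) := by
    push_cast
    calc (k * l : ℝ) * (⟪α, α⟫_ℝ * ⟪β, β⟫_ℝ)
        = (k * ⟪α, α⟫_ℝ) * (l * ⟪β, β⟫_ℝ) := by ring
      _ = 4 * (⟪α, β⟫_ℝ * ⟪α, β⟫_ℝ) := by rw [← hk, ← hl]; ring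
      _ ≤ _ := by linarith
  exact_mod_cast le_of_mul_le_mul_right this (mul_pos h1 h2)

/-- If a Cartan integer of two distinct roots is at least `2`, the opposite one is `1`. -/
lemma inner_self_of_two_le {α β : V} (hα : α ∈ Φ.R) (hβ : β ∈ Φ.R) (hne : β ≠ α) {k : ℤ}
    (hk : 2 * ⟪β, α⟫_ℝ = k * ⟪α, α⟫_ℝ) (h2 : 2 ≤ k) :
    ⟪β, β⟫_ℝ = k * ⟪α, α⟫_ℝ ∧ k ≤ 3 := by
  obtain ⟨l, hl, -⟩ := Φ.exists_cartan hβ hα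
  have hkl := Φ.cartan_mul_le hα hβ hk hl
  have h1 := Φ.inner_self_pos_of_mem hα
  have h3 := Φ.inner_self_pos_of_mem hβ
  have hl' := hl
  rw [real_inner_comm β α] at hl
  have hl0 : 0 < l := by
    have : (0 : ℝ) < l * ⟪β, β⟫_ℝ := by
      rw [← hl, hk]
      have : (2 : ℝ) ≤ k := by exact_mod_cast h2
      positivity
    exact_mod_cast (pos_iff_pos_of_mul_pos this).mpr h3
  rcases (by omega : l = 1 ∨ 2 ≤ l) with rfl | hl2
  · have hB : ⟪β, β⟫_ℝ = k * ⟪α, α⟫_ℝ := by rw [← hk, hl]; simp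
    refine ⟨hB, ?_⟩
    by_contra hk3
    obtain rfl : k = 4 := by omega
    have h0 : β - (2 : ℝ) • α = 0 := by
      rw [← inner_self_eq_zero (𝕜 := ℝ)]
      simp only [inner_sub_left, inner_sub_right, inner_smul_left, inner_smul_right,
        conj_trivial]
      rw [real_inner_comm β α]
      push_cast at hk hB
      linarith
    rw [sub_eq_zero] at h0
    rcases Φ.reduced α hα 2 (h0 ▸ hβ) with h | h <;> norm_num at h
  · exfalso
    have hk2 : k = 2 := by nlinarith
    have hl2 : l = 2 := by nlinarith
    subst hk2 hl2
    apply hne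
    rw [← sub_eq_zero, ← inner_self_eq_zero (𝕜 := ℝ), inner_sub_left, inner_sub_right,
      inner_sub_right, real_inner_comm β α]
    push_cast at hk hl
    linarith

lemma inner_self_of_le_neg_two {α β : V} (hα : α ∈ Φ.R) (hβ : β ∈ Φ.R) (hne : β ≠ -α) {k : ℕ}
    (hk : 2 * ⟪β, α⟫_ℝ = -k * ⟪α, α⟫_ℝ) (h2 : 2 ≤ k) :
    ⟪β, β⟫_ℝ = k * ⟪α, α⟫_ℝ ∧ k ≤ 3 := by
  have := Φ.inner_self_of_two_le (Φ.neg_mem hα) hβ hne (k := k)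
    (by rw [inner_neg_right, inner_neg_neg]; push_cast; linarith) (by exact_mod_cast h2)
  rw [inner_neg_neg] at this
  exact_mod_cast this

lemma sub_mem_of_inner_pos {α β : V} (hα : α ∈ Φ.R) (hβ : β ∈ Φ.R) (hne : β ≠ α)
    (h : 0 < ⟪β, α⟫_ℝ) : β - α ∈ Φ.R := by
  obtain ⟨k, hk, hk'⟩ := Φ.exists_cartan hα hβ
  have h1 := Φ.inner_self_pos_of_mem hα
  have hk0 : 0 < k := by
    have : (0 : ℝ) < k * ⟪α, α⟫_ℝ := by rw [← hk]; linarith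
    exact_mod_cast (pos_iff_pos_of_mul_pos this).mpr h1
  rcases (by omega : k = 1 ∨ 2 ≤ k) with rfl | h2
  · simpa using hk'
  · have h3 := (Φ.inner_self_of_two_le hα hβ hne hk h2).1
    have := Φ.reflect_mem_of_eq (k := 1) hβ hα (by rw [real_inner_comm, hk, h3, one_mul])
    have := Φ.neg_mem this
    simpa using this

lemma add_mem_of_inner_neg {α β : V} (hα : α ∈ Φ.R) (hβ : β ∈ Φ.R) (hne : β ≠ -α)
    (h : ⟪β, α⟫_ℝ < 0) : β + α ∈ Φ.R := by
  have := Φ.sub_mem_of_inner_pos (Φ.neg_mem hα) hβ hne (by rw [inner_neg_right]; linarith)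
  simpa using this

lemma inner_pos_of_string_not_mem {α β : V} (hα : α ∈ Φ.R) (hne : ∀ t : ℝ, β ≠ t • α)
    (hβ : β ∈ Φ.R) (k : ℕ) (hk : β + (k : ℝ) • α ∉ Φ.R) : 0 < ⟪β + (k : ℝ) • α, α⟫_ℝ := by
  have hA := Φ.inner_self_pos_of_mem hα
  induction k with
  | zero => simp [hβ] at hk
  | succ k ih =>
    have hs : β + ((k + 1 : ℕ) : ℝ) • α = β + (k : ℝ) • α + α := by push_cast; module
    rw [hs] at hk ⊢
    rw [inner_add_left _ α]
    by_cases hmem : β + (k : ℝ) • α ∈ Φ.R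
    · have : 0 ≤ ⟪β + (k : ℝ) • α, α⟫_ℝ := by
        by_contra hneg
        refine hk (Φ.add_mem_of_inner_neg hα hmem (fun h => hne (-1 - k) ?_) (not_le.mp hneg))
        rw [sub_smul, neg_one_smul, ← h, add_sub_cancel_right]
      linarith
    · linarith [ih hmem]

/-- Root strings are unbroken. -/
lemma string_mem {α β : V} (hα : α ∈ Φ.R) (hne : ∀ t : ℝ, β ≠ t • α) {N : ℕ}
    (hβ : β ∈ Φ.R) (hN : β + (N : ℝ) • α ∈ Φ.R) {k : ℕ} (hk : k ≤ N) :
    β + (k : ℝ) • α ∈ Φ.R := by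
  by_contra hcon
  have h1 := Φ.inner_pos_of_string_not_mem hα hne hβ k hcon
  have hs : β + (N : ℝ) • α + ((N - k : ℕ) : ℝ) • (-α) = β + (k : ℝ) • α := by
    push_cast [hk]; module
  have h2 := Φ.inner_pos_of_string_not_mem (Φ.neg_mem hα) (β := β + (N : ℝ) • α)
    (fun t h => hne (-t - N) (by
      rw [sub_smul, neg_smul, ← smul_neg, ← h, add_sub_cancel_right])) hN (N - k) (by rwa [hs])
  rw [hs, inner_neg_right] at h2
  linarith

/-- If `β` and `β + α` are roots and `⟪β, α⟫ ≥ 0`, then `α` and `β` have the same length. -/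
lemma inner_self_eq_of_add_mem {α β : V} (hα : α ∈ Φ.R) (hβ : β ∈ Φ.R) (hs : β + α ∈ Φ.R)
    (h : 0 ≤ ⟪β, α⟫_ℝ) : ⟪β, β⟫_ℝ = ⟪α, α⟫_ℝ := by
  obtain ⟨k, hk, -⟩ := Φ.exists_cartan hα hs
  have hA := Φ.inner_self_pos_of_mem hα
  have h2 : 2 ≤ k := by
    have : (2 : ℝ) * ⟪α, α⟫_ℝ ≤ k * ⟪α, α⟫_ℝ := by
      rw [← hk, inner_add_left]; linarith
    exact_mod_cast le_of_mul_le_mul_right this hA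
  have hne : β + α ≠ α := by
    intro h0
    rw [add_eq_right] at h0
    exact Φ.zero_not_mem (h0 ▸ hβ)
  have := (Φ.inner_self_of_two_le hα hs hne hk h2).1
  rw [← hk] at this
  simp only [inner_add_left, inner_add_right] at this
  rw [real_inner_comm β α] at this
  linarith

/-! ### Coordinates -/

/-- The simple roots form a basis of the ambient space. -/
noncomputable def basis : Module.Basis (Fin n) ℝ V :=
  Module.Basis.mk Φ.simple_linearIndependent (by
    rw [← Φ.span_eq_top, Submodule.span_le]
    intro β hβ
    rw [SetLike.mem_coe, Φ.root_eq_sum β hβ]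
    exact Submodule.sum_mem _ fun i _ =>
      Submodule.smul_mem _ _ (Submodule.subset_span (Set.mem_range_self i)))

lemma basis_apply (i : Fin n) : Φ.basis i = Φ.simple i := by
  simp [basis]

/-- The linear coordinate function extending `coord`. -/
noncomputable def lcoord (i : Fin n) : V →ₗ[ℝ] ℝ := Φ.basis.coord i

lemma lcoord_simple (i j : Fin n) : Φ.lcoord i (Φ.simple j) = if i = j then 1 else 0 := by
  rw [lcoord, ← basis_apply, Module.Basis.coord_apply, Module.Basis.repr_self,
    Finsupp.single_apply]
  simp [eq_comm]

@[simp] lemma lcoord_simple_self (i : Fin n) : Φ.lcoord i (Φ.simple i) = 1 := by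
  simp [lcoord_simple]

lemma lcoord_simple_ne {i j : Fin n} (h : i ≠ j) : Φ.lcoord i (Φ.simple j) = 0 := by
  simp [lcoord_simple, h]

lemma lcoord_eq {β : V} (hβ : β ∈ Φ.R) (i : Fin n) : Φ.lcoord i β = Φ.coord β i := by
  conv_lhs => rw [Φ.root_eq_sum β hβ]
  simp [lcoord_simple]

lemma sum_lcoord (v : V) : ∑ i, Φ.lcoord i v • Φ.simple i = v := by
  simp_rw [← basis_apply]
  exact Φ.basis.sum_repr v

lemma isPos_iff {β : V} : Φ.IsPos β ↔ β ∈ Φ.R ∧ ∀ i, 0 ≤ Φ.lcoord i β := by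
  refine and_congr_right fun hβ => forall_congr' fun i => ?_
  rw [Φ.lcoord_eq hβ]
  exact_mod_cast Iff.rfl

lemma IsPos.lcoord_nonneg {Φ : RootSystemBase n V} {β : V} (h : Φ.IsPos β) (i : Fin n) :
    0 ≤ Φ.lcoord i β := (Φ.isPos_iff.mp h).2 i

lemma isPos_of_lcoord_pos {β : V} (hβ : β ∈ Φ.R) {i : Fin n} (hi : 0 < Φ.lcoord i β) :
    Φ.IsPos β := by
  rcases Φ.coord_sign β hβ with h | h
  · exact ⟨hβ, h⟩
  · rw [Φ.lcoord_eq hβ] at hi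
    exact absurd (h i) (not_le.mpr (by exact_mod_cast hi))

lemma isPos_simple (i : Fin n) : Φ.IsPos (Φ.simple i) :=
  Φ.isPos_of_lcoord_pos (Φ.simple_mem i) (i := i) (by simp)

lemma ext_lcoord {u v : V} (h : ∀ i, Φ.lcoord i u = Φ.lcoord i v) : u = v := by
  rw [← Φ.sum_lcoord u, ← Φ.sum_lcoord v]
  simp [h]

lemma IsPos.ne_zero {Φ : RootSystemBase n V} {β : V} (h : Φ.IsPos β) : β ≠ 0 := by
  rintro rfl
  exact Φ.zero_not_mem h.1

lemma isPos_or_isPos_neg {β : V} (hβ : β ∈ Φ.R) : Φ.IsPos β ∨ Φ.IsPos (-β) := by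
  rcases Φ.coord_sign β hβ with h | h
  · exact Or.inl ⟨hβ, h⟩
  · refine Or.inr (Φ.isPos_iff.mpr ⟨Φ.neg_mem hβ, fun i => ?_⟩)
    rw [map_neg, Φ.lcoord_eq hβ, neg_nonneg]
    exact_mod_cast h i

lemma IsPos.add {Φ : RootSystemBase n V} {α β : V} (hα : Φ.IsPos α) (hβ : Φ.IsPos β)
    (h : α + β ∈ Φ.R) : Φ.IsPos (α + β) := by
  refine Φ.isPos_iff.mpr ⟨h, fun i => ?_⟩
  rw [map_add]
  exact add_nonneg (hα.lcoord_nonneg i) (hβ.lcoord_nonneg i)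

lemma IsPos.one_le_level {Φ : RootSystemBase n V} {β : V} (h : Φ.IsPos β) : 1 ≤ Φ.level β := by
  have h0 : 0 ≤ Φ.level β := Finset.sum_nonneg fun i _ => h.2 i
  by_contra hlt
  have hz : ∑ i, Φ.coord β i = 0 := by
    change Φ.level β = 0
    omega
  rw [Finset.sum_eq_zero_iff_of_nonneg fun i _ => h.2 i] at hz
  refine h.ne_zero ?_
  rw [Φ.root_eq_sum β h.1]
  simp [fun i => hz i (Finset.mem_univ i)]

lemma coord_add {α β : V} (hα : α ∈ Φ.R) (hβ : β ∈ Φ.R) (h : α + β ∈ Φ.R) (i : Fin n) :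
    Φ.coord (α + β) i = Φ.coord α i + Φ.coord β i := by
  have := Φ.lcoord_eq h i
  rw [map_add, Φ.lcoord_eq hα, Φ.lcoord_eq hβ] at this
  exact_mod_cast this.symm

lemma level_add {α β : V} (hα : α ∈ Φ.R) (hβ : β ∈ Φ.R) (h : α + β ∈ Φ.R) :
    Φ.level (α + β) = Φ.level α + Φ.level β := by
  simp [level, Φ.coord_add hα hβ h, Finset.sum_add_distrib]

lemma coord_simple (i j : Fin n) : Φ.coord (Φ.simple j) i = if i = j then 1 else 0 := by
  have := Φ.lcoord_simple i j
  rw [Φ.lcoord_eq (Φ.simple_mem j)] at this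
  split_ifs at this ⊢ <;> exact_mod_cast this

lemma level_simple (i : Fin n) : Φ.level (Φ.simple i) = 1 := by
  simp [level, coord_simple]

/-- A simple root is not a sum of two positive roots. -/
lemma add_ne_simple {α β : V} (hα : Φ.IsPos α) (hβ : Φ.IsPos β) (i : Fin n) :
    α + β ≠ Φ.simple i := by
  intro h
  have h1 := Φ.level_add hα.1 hβ.1 (h ▸ Φ.simple_mem i)
  rw [h, level_simple] at h1
  linarith [hα.one_le_level, hβ.one_le_level]

lemma simple_sub_simple_not_mem (i j : Fin n) : Φ.simple i - Φ.simple j ∉ Φ.R := by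
  intro h
  rcases Φ.isPos_or_isPos_neg h with h | h
  · exact Φ.add_ne_simple h (Φ.isPos_simple j) i (by abel)
  · exact Φ.add_ne_simple h (Φ.isPos_simple i) j (by abel)

lemma simple_ne {i j : Fin n} (h : i ≠ j) : Φ.simple i ≠ Φ.simple j :=
  fun h' => h (Φ.simple_linearIndependent.injective h')

lemma inner_simple_nonpos {i j : Fin n} (h : i ≠ j) : ⟪Φ.simple i, Φ.simple j⟫_ℝ ≤ 0 := by
  by_contra hpos
  exact Φ.simple_sub_simple_not_mem i j
    (Φ.sub_mem_of_inner_pos (Φ.simple_mem j) (Φ.simple_mem i) (Φ.simple_ne h) (not_le.mp hpos))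

/-- A positive root other than `αᵢ` involves some other simple root. -/
lemma IsPos.exists_lcoord_pos {Φ : RootSystemBase n V} {β : V} (h : Φ.IsPos β) {i : Fin n}
    (hne : β ≠ Φ.simple i) : ∃ j, j ≠ i ∧ 0 < Φ.lcoord j β := by
  by_contra! hcon
  have hβ : β = Φ.lcoord i β • Φ.simple i := by
    refine Φ.ext_lcoord fun j => ?_
    rw [map_smul, lcoord_simple]
    by_cases hj : j = i
    · simp [hj]
    · simp [hj, le_antisymm (hcon j hj) (h.lcoord_nonneg j)]
  have hmem := h.1
  rw [hβ] at hmem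
  rcases Φ.reduced _ (Φ.simple_mem i) _ hmem with h1 | h1
  · rw [h1, one_smul] at hβ
    exact hne hβ
  · have := h.lcoord_nonneg i
    linarith

lemma ne_smul_simple {β : V} {i j : Fin n} (hj : j ≠ i) (h : 0 < Φ.lcoord j β) (t : ℝ) :
    β ≠ t • Φ.simple i := by
  rintro rfl
  simp [Φ.lcoord_simple_ne hj] at h

/-- Every positive root that is not simple is obtained by adding a simple root to a positive
root. -/
lemma IsPos.exists_sub_simple {Φ : RootSystemBase n V} {β : V} (h : Φ.IsPos β)
    (hne : ∀ i, β ≠ Φ.simple i) : ∃ i, Φ.IsPos (β - Φ.simple i) := by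
  have hpos := Φ.inner_self_pos_of_mem h.1
  obtain ⟨i, hi⟩ : ∃ i, 0 < ⟪β, Φ.simple i⟫_ℝ := by
    by_contra! hcon
    conv at hpos => rhs; arg 3; rw [← Φ.sum_lcoord β]
    rw [inner_sum] at hpos
    refine absurd hpos (not_lt.mpr (Finset.sum_nonpos fun i _ => ?_))
    rw [inner_smul_right]
    exact mul_nonpos_of_nonneg_of_nonpos (h.lcoord_nonneg i) (hcon i)
  obtain ⟨j, hj, hjp⟩ := h.exists_lcoord_pos (hne i)
  refine ⟨i, Φ.isPos_of_lcoord_pos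
    (Φ.sub_mem_of_inner_pos (Φ.simple_mem i) h.1 (hne i) hi) (i := j) ?_⟩
  rwa [map_sub, Φ.lcoord_simple_ne hj, sub_zero]

/-- Induction over positive roots by adding simple roots. -/
lemma IsPos.induction {Φ : RootSystemBase n V} {P : V → Prop} (hs : ∀ i, P (Φ.simple i))
    (ha : ∀ β i, Φ.IsPos β → Φ.IsPos (β + Φ.simple i) → P β → P (β + Φ.simple i))
    {β : V} (h : Φ.IsPos β) : P β := by
  obtain ⟨k, hk⟩ : ∃ k : ℕ, Φ.level β ≤ k := ⟨_, Int.self_le_toNat _⟩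
  induction k generalizing β with
  | zero => linarith [h.one_le_level, (by exact_mod_cast hk : Φ.level β ≤ 0)]
  | succ k ih =>
    by_cases hne : ∀ i, β ≠ Φ.simple i
    · obtain ⟨i, hi⟩ := h.exists_sub_simple hne
      have hb : β - Φ.simple i + Φ.simple i = β := sub_add_cancel _ _
      rw [← hb] at h ⊢
      refine ha _ i hi h (ih hi ?_)
      have := Φ.level_add hi.1 (Φ.simple_mem i) h.1
      rw [hb, level_simple] at this
      push_cast at hk
      linarith
    · push Not at hne
      obtain ⟨i, rfl⟩ := hne
      exact hs i

/-- Simple reflections permute the positive roots other than the simple root. -/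
lemma IsPos.reflect {Φ : RootSystemBase n V} {β : V} (h : Φ.IsPos β) {i : Fin n}
    (hne : β ≠ Φ.simple i) {k : ℝ}
    (hk : 2 * ⟪β, Φ.simple i⟫_ℝ = k * ⟪Φ.simple i, Φ.simple i⟫_ℝ) :
    Φ.IsPos (β - k • Φ.simple i) := by
  obtain ⟨j, hj, hjp⟩ := h.exists_lcoord_pos hne
  refine Φ.isPos_of_lcoord_pos (Φ.reflect_mem_of_eq (Φ.simple_mem i) h.1 hk) (i := j) ?_
  rwa [map_sub, map_smul, Φ.lcoord_simple_ne hj, smul_zero, sub_zero]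

/-- Strings of positive roots in the direction of a simple root are unbroken. -/
lemma IsPos.string {Φ : RootSystemBase n V} {β : V} (h : Φ.IsPos β) {i : Fin n}
    (hne : β ≠ Φ.simple i) {N k : ℕ} (hN : β + (N : ℝ) • Φ.simple i ∈ Φ.R) (hk : k ≤ N) :
    Φ.IsPos (β + (k : ℝ) • Φ.simple i) := by
  obtain ⟨j, hj, hjp⟩ := h.exists_lcoord_pos hne
  refine Φ.isPos_of_lcoord_pos (Φ.string_mem (Φ.simple_mem i) (Φ.ne_smul_simple hj hjp)
    h.1 hN hk) (i := j) ?_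
  rwa [map_add, map_smul, Φ.lcoord_simple_ne hj, smul_zero, add_zero]

end RootSystemBase

namespace RootSystemBase

variable {n : ℕ} {V : Type*} [NormedAddCommGroup V] [InnerProductSpace ℝ V]
variable (Φ : RootSystemBase n V)

/-! ### The highest root -/

variable {Φ} in
lemma IsHighest.lcoord_le {μ β : V} (hμ : Φ.IsHighest μ) (hβ : Φ.IsPos β) (i : Fin n) :
    Φ.lcoord i β ≤ Φ.lcoord i μ := by
  rw [Φ.lcoord_eq hβ.1, Φ.lcoord_eq hμ.1.1]
  exact_mod_cast hμ.2 β hβ i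

variable {Φ} in
lemma IsHighest.add_not_mem {μ β : V} (hμ : Φ.IsHighest μ) (hβ : Φ.IsPos β) : μ + β ∉ Φ.R := by
  intro h
  refine hβ.ne_zero (Φ.ext_lcoord fun i => ?_)
  have := hμ.lcoord_le (hμ.1.add hβ h) i
  rw [map_add] at this
  rw [map_zero]
  linarith [hβ.lcoord_nonneg i]

variable {Φ} in
lemma IsHighest.one_le_lcoord {μ : V} (hμ : Φ.IsHighest μ) (i : Fin n) : 1 ≤ Φ.lcoord i μ := by
  simpa using hμ.lcoord_le (Φ.isPos_simple i) i

variable {Φ} in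
lemma IsHighest.ne_simple {μ : V} (hμ : Φ.IsHighest μ) (hrank : 2 ≤ n) (i : Fin n) :
    μ ≠ Φ.simple i := by
  rintro rfl
  have : Nontrivial (Fin n) := Fin.nontrivial_iff_two_le.mpr hrank
  obtain ⟨j, hj⟩ := exists_ne i
  have := hμ.one_le_lcoord j
  rw [Φ.lcoord_simple_ne hj] at this
  linarith

variable {Φ} in
/-- The `αᵢ`-string through the highest root has length `⟨μ, αᵢ^∨⟩`. -/
lemma IsHighest.cartan_eq {μ : V} (hμ : Φ.IsHighest μ) (hrank : 2 ≤ n) (i : Fin n) {m : ℕ}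
    (hm : ∀ k : ℕ, k ≤ m → Φ.IsPos (μ - k • Φ.simple i))
    (hm' : ¬ Φ.IsPos (μ - (m + 1) • Φ.simple i)) :
    2 * ⟪μ, Φ.simple i⟫_ℝ = m * ⟪Φ.simple i, Φ.simple i⟫_ℝ := by
  obtain ⟨j, hj, hjp⟩ := hμ.1.exists_lcoord_pos (hμ.ne_simple hrank i)
  have hA := Φ.inner_self_pos_of_mem (Φ.simple_mem i)
  obtain ⟨k, hk, hk'⟩ := Φ.exists_cartan (Φ.simple_mem i) hμ.1.1
  have hk0 : 0 ≤ k := by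
    by_contra hneg
    have hneg' : (k : ℝ) < 0 := by exact_mod_cast not_le.mp hneg
    refine hμ.add_not_mem (Φ.isPos_simple i) (Φ.add_mem_of_inner_neg (Φ.simple_mem i) hμ.1.1
      ?_ (by nlinarith))
    simpa using Φ.ne_smul_simple hj hjp (-1)
  lift k to ℕ using hk0
  rw [hk]
  congr 2
  rcases lt_trichotomy k m with h | h | h
  · exfalso
    have h1 := (hm (k + 1) h).1
    refine hμ.add_not_mem (Φ.isPos_simple i) ?_
    have h2 := Φ.reflect_mem_of_eq (k := -k - 2) (Φ.simple_mem i) h1 (by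
      rw [← Nat.cast_smul_eq_nsmul ℝ, inner_sub_left, inner_smul_left, mul_sub, hk]
      simp only [conj_trivial]
      push_cast
      ring)
    rw [← Nat.cast_smul_eq_nsmul ℝ] at h2
    rwa [show μ + Φ.simple i =
      μ - ((k + 1 : ℕ) : ℝ) • Φ.simple i - (-k - 2 : ℝ) • Φ.simple i by push_cast; module]
  · simp [h]
  · exfalso
    refine hm' (Φ.isPos_of_lcoord_pos (i := j) ?_ ?_)
    · have := Φ.string_mem (N := k) (k := m + 1) (Φ.neg_mem (Φ.simple_mem i)) (β := μ)
        (fun t => by simpa using Φ.ne_smul_simple hj hjp (-t)) hμ.1.1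
        (by simpa [sub_eq_add_neg] using hk') h
      rwa [smul_neg, ← sub_eq_add_neg, Nat.cast_smul_eq_nsmul] at this
    · rwa [map_sub, map_nsmul, Φ.lcoord_simple_ne hj, smul_zero, sub_zero]

/-! ### Weights of outer derivations -/

/-- If `λ`, `λ + αᵢ` and `λ + αⱼ` are roots, then `λ` makes an obtuse angle with `αᵢ` or `αⱼ`. -/
lemma inner_neg_or_inner_neg {i j : Fin n} (hij : i ≠ j) {v : V} (hv : v ∈ Φ.R)
    (hi : v + Φ.simple i ∈ Φ.R) (hj : v + Φ.simple j ∈ Φ.R) :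
    ⟪v, Φ.simple i⟫_ℝ < 0 ∨ ⟪v, Φ.simple j⟫_ℝ < 0 := by
  by_contra! hcon
  have h1 := Φ.inner_self_eq_of_add_mem (Φ.simple_mem i) hv hi hcon.1
  have h2 := Φ.inner_self_eq_of_add_mem (Φ.simple_mem j) hv hj hcon.2
  have h3 : ⟪v + Φ.simple i, v + Φ.simple j⟫_ℝ ≤ 0 := by
    by_contra hpos
    refine Φ.simple_sub_simple_not_mem i j ?_
    have := Φ.sub_mem_of_inner_pos hj hi (by simpa using Φ.simple_ne hij) (not_le.mp hpos)
    simpa using this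
  have h4 : 0 < ⟪Φ.simple i + Φ.simple j, Φ.simple i + Φ.simple j⟫_ℝ := by
    rw [real_inner_self_pos]
    intro h0
    have := congrArg (Φ.lcoord i) h0
    simp [Φ.lcoord_simple_ne hij] at this
  simp only [inner_add_left, inner_add_right] at h3 h4
  rw [real_inner_comm (Φ.simple i) (Φ.simple j)] at h4
  rw [real_inner_comm v (Φ.simple i)] at h3
  linarith [hcon.1, hcon.2]

lemma inner_nonpos_of_not_mem {α β : V} (hα : α ∈ Φ.R) (hβ : β ∈ Φ.R) (h : β - α ∉ Φ.R)
    (h0 : β - α ≠ 0) : ⟪β, α⟫_ℝ ≤ 0 := by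
  by_contra hpos
  exact h (Φ.sub_mem_of_inner_pos hα hβ (sub_ne_zero.mp h0) (not_le.mp hpos))

/-- A nonzero weight which is not a root leads from at most one simple root to a positive root. -/
lemma not_isPos_add_simple {i j : Fin n} (hij : i ≠ j) {v : V} (hv : v ∉ Φ.R) (hv0 : v ≠ 0)
    (hi : Φ.IsPos (v + Φ.simple i)) : ¬ Φ.IsPos (v + Φ.simple j) := by
  intro hj
  have h1 := Φ.inner_nonpos_of_not_mem (Φ.simple_mem i) hi.1 (by simpa) (by simpa)
  have h2 := Φ.inner_nonpos_of_not_mem (Φ.simple_mem j) hj.1 (by simpa) (by simpa)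
  have h3 := Φ.inner_nonpos_of_not_mem hj.1 hi.1
    (by simpa using Φ.simple_sub_simple_not_mem i j)
    (by simpa [sub_eq_zero] using Φ.simple_ne hij)
  have h4 := Φ.inner_simple_nonpos hij
  have h5 : ⟪v + Φ.simple i + Φ.simple j, v + Φ.simple i + Φ.simple j⟫_ℝ ≤ 0 := by
    simp only [inner_add_left, inner_add_right] at h1 h2 h3 ⊢
    rw [real_inner_comm (Φ.simple i) (Φ.simple j), real_inner_comm v (Φ.simple j),
      real_inner_comm v (Φ.simple i)]
    rw [real_inner_comm v (Φ.simple i)] at h3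
    linarith
  have h6 := real_inner_self_nonpos.mp h5
  have h7 := congrArg (Φ.lcoord j) h6
  rw [map_add, lcoord_simple_self, map_zero] at h7
  linarith [hi.lcoord_nonneg j]

/-- If `v + αᵢ` is a positive root, then `v` is not a negative root. -/
lemma not_mem_of_not_isPos {i : Fin n} {v : V} (hv : ¬ Φ.IsPos v)
    (hi : Φ.IsPos (v + Φ.simple i)) : v ∉ Φ.R := by
  intro h
  rcases Φ.isPos_or_isPos_neg h with h | h
  · exact hv h
  · exact Φ.add_ne_simple hi h i (by abel)

/-- The exceptional configuration of roots, in terms of Cartan integers. -/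
lemma cartan_eq_two_one {x y β : V} (hx : x ∈ Φ.R) (hy : y ∈ Φ.R) (hβ : β ∈ Φ.R)
    (hyx : y ≠ -x) (hβx : β ≠ -x) {a q : ℕ} (ha : 2 ≤ a) (hq : 1 ≤ q)
    (hya : 2 * ⟪y, x⟫_ℝ = -a * ⟪x, x⟫_ℝ) (hβq : 2 * ⟪β, x⟫_ℝ = -q * ⟪x, x⟫_ℝ)
    (hβy : 0 ≤ ⟪β, y⟫_ℝ)
    (hz : β + y + ((a : ℝ) - 1) • x ∈ Φ.R) (hz0 : β + y + ((a : ℝ) - 1) • x ≠ -x)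
    (ht : β + y + (a : ℝ) • x ∈ Φ.R) (ht0 : β + y + (a : ℝ) • x ≠ x) :
    a = 2 ∧ q = 1 := by
  have hA := Φ.inner_self_pos_of_mem hx
  obtain ⟨hyy, ha3⟩ := Φ.inner_self_of_le_neg_two hx hy hyx hya ha
  obtain ⟨s, hs, -⟩ := Φ.exists_cartan hy hβ
  have hs0 : 0 ≤ s := by
    have h : (0 : ℝ) ≤ s * ⟪y, y⟫_ℝ := by linarith
    exact_mod_cast nonneg_of_mul_nonneg_left h (Φ.inner_self_pos_of_mem hy)
  rw [hyy] at hs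
  obtain ⟨r, hr, -⟩ := Φ.exists_cartan hβ hy
  rw [real_inner_comm β y] at hr
  obtain ⟨l, hl, -⟩ := Φ.exists_cartan hβ hx
  rw [real_inner_comm β x, hβq] at hl
  have hrs := Φ.cartan_mul_le hβ hy (k := r) (l := s) (by rw [real_inner_comm, hr])
    (by rw [hs, hyy])
  have hB := Φ.inner_self_pos_of_mem hβ
  have hqB : 2 ≤ q → ⟪β, β⟫_ℝ = q * ⟪x, x⟫_ℝ ∧ q ≤ 3 :=
    Φ.inner_self_of_le_neg_two hx hβ hβx hβq
  have hq3 : q ≤ 3 := by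
    by_contra h
    exact h (hqB (by omega)).2
  have hzz : ⟪β + y + ((a : ℝ) - 1) • x, β + y + ((a : ℝ) - 1) • x⟫_ℝ = ⟪β, β⟫_ℝ +
      2 * ⟪β, y⟫_ℝ + (a + (a - 1) ^ 2 - (a - 1) * q - (a - 1) * a) * ⟪x, x⟫_ℝ := by
    simp only [inner_add_left, inner_add_right, inner_smul_left, inner_smul_right, conj_trivial]
    rw [real_inner_comm β y, real_inner_comm β x, real_inner_comm y x, hyy]
    linear_combination ((a : ℝ) - 1) * hya + ((a : ℝ) - 1) * hβq
  have hzx : 2 * ⟪β + y + ((a : ℝ) - 1) • x, x⟫_ℝ = (a - 2 - q) * ⟪x, x⟫_ℝ := by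
    simp only [inner_add_left, inner_smul_left, conj_trivial]
    linear_combination hya + hβq
  have htt : ⟪β + y + (a : ℝ) • x, β + y + (a : ℝ) • x⟫_ℝ = ⟪β, β⟫_ℝ +
      2 * ⟪β, y⟫_ℝ + (a - a * q) * ⟪x, x⟫_ℝ := by
    simp only [inner_add_left, inner_add_right, inner_smul_left, inner_smul_right, conj_trivial]
    rw [real_inner_comm β y, real_inner_comm β x, real_inner_comm y x, hyy]
    linear_combination (a : ℝ) * hya + (a : ℝ) * hβq
  have htx : 2 * ⟪β + y + (a : ℝ) • x, x⟫_ℝ = (a - q) * ⟪x, x⟫_ℝ := by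
    simp only [inner_add_left, inner_smul_left, conj_trivial]
    linear_combination hya + hβq
  have cancel : ∀ u v : ℤ, (u : ℝ) * ⟪x, x⟫_ℝ = v * ⟪x, x⟫_ℝ → u = v := fun u v h => by
    exact_mod_cast mul_right_cancel₀ hA.ne' h
  have ht_pos := Φ.inner_self_pos_of_mem ht
  interval_cases a <;> interval_cases q
  · exact ⟨rfl, rfl⟩
  · exfalso
    have h1 := (hqB le_rfl).1
    have h2 := (Φ.inner_self_of_le_neg_two hx hz hz0 (k := 2)
      (by rw [hzx]; push_cast; ring) le_rfl).1
    have := cancel (s * 2) 1 (by push_cast at *; linarith)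
    omega
  · exfalso
    have h1 := (hqB (by norm_num)).1
    have h2 := (Φ.inner_self_of_le_neg_two hx hz hz0 (k := 3)
      (by rw [hzx]; push_cast; ring) (by norm_num)).1
    rw [h1] at hr
    have := cancel (r * 3) 2 (by push_cast at *; linarith)
    omega
  · exfalso
    have h2 := (Φ.inner_self_of_two_le hx ht ht0 (k := 2)
      (by rw [htx]; push_cast; ring) le_rfl).1
    have hl0 : l < 0 := by
      have : (0 : ℝ) < (-l) * ⟪β, β⟫_ℝ := by push_cast at hl; linarith
      have := (pos_iff_pos_of_mul_pos this).mpr hB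
      exact_mod_cast (neg_pos.mp this)
    have hl1 : (l : ℝ) ≤ -1 := by exact_mod_cast (by omega : l ≤ -1)
    have hBA : ⟪β, β⟫_ℝ ≤ ⟪x, x⟫_ℝ := by push_cast at hl; nlinarith
    push_cast at *
    rcases (by omega : s ≤ 0 ∨ 1 ≤ s) with h | h
    · have : (s : ℝ) ≤ 0 := by exact_mod_cast h
      nlinarith
    · have : (1 : ℝ) ≤ s := by exact_mod_cast h
      nlinarith
  · exfalso
    have h1 := (hqB le_rfl).1
    rw [h1] at hr
    have h3 := cancel (r * 2) (s * 3) (by push_cast at *; linarith)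
    have h4 : (0 : ℝ) < ((s * 3 - 1 : ℤ) : ℝ) * ⟪x, x⟫_ℝ := by push_cast at *; linarith
    have h5 : 0 < s * 3 - 1 := by exact_mod_cast (pos_iff_pos_of_mul_pos h4).mpr hA
    have h6 : 2 ≤ s := by omega
    nlinarith
  · exfalso
    have h1 := (hqB (by norm_num)).1
    have h2 := (Φ.inner_self_of_le_neg_two hx hz hz0 (k := 2)
      (by rw [hzx]; push_cast; ring) le_rfl).1
    have := cancel (s * 3) 4 (by push_cast at *; linarith)
    omega

end RootSystemBase

namespace ChevalleyNilradical

open LieAlgebra RootSystemBase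

variable {n : ℕ} {V : Type*} [NormedAddCommGroup V] [InnerProductSpace ℝ V]
  {Φ : RootSystemBase n V} {L : Type*} [LieRing L] [LieAlgebra ℂ L]
  (C : ChevalleyNilradical Φ L)

/-! ### Root vectors and weight components -/

open Classical in
/-- The root vector `e_β`, extended by zero to all `β : V`. -/
noncomputable def vec (β : V) : L := if h : Φ.IsPos β then C.e ⟨β, h⟩ else 0

lemma vec_of_isPos {β : V} (h : Φ.IsPos β) : C.vec β = C.e ⟨β, h⟩ := dif_pos h

lemma vec_of_not_isPos {β : V} (h : ¬ Φ.IsPos β) : C.vec β = 0 := dif_neg h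

lemma vec_ne_zero {β : V} (h : Φ.IsPos β) : C.vec β ≠ 0 := by
  rw [C.vec_of_isPos h]
  exact C.e.ne_zero _

lemma isPos_of_vec_ne_zero {β : V} (h : C.vec β ≠ 0) : Φ.IsPos β := by
  by_contra hβ
  exact h (C.vec_of_not_isPos hβ)

lemma lie_vec {α β : V} (hα : Φ.IsPos α) (hβ : Φ.IsPos β) :
    ⁅C.vec α, C.vec β⁆ = C.N α β • C.vec (α + β) := by
  rw [C.vec_of_isPos hα, C.vec_of_isPos hβ]
  by_cases h : Φ.IsPos (α + β)
  · rw [C.vec_of_isPos h]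
    exact C.lie_eq ⟨α, hα⟩ ⟨β, hβ⟩ h
  · rw [C.vec_of_not_isPos h, smul_zero]
    exact C.lie_eq_zero ⟨α, hα⟩ ⟨β, hβ⟩ h

lemma lie_vec_ne_zero {α β : V} (hα : Φ.IsPos α) (hβ : Φ.IsPos β) (h : α + β ∈ Φ.R) :
    ⁅C.vec α, C.vec β⁆ ≠ 0 := by
  have h := hα.add hβ h
  rw [C.lie_vec hα hβ]
  exact smul_ne_zero (C.N_ne_zero ⟨α, hα⟩ ⟨β, hβ⟩ h) (C.vec_ne_zero h)

lemma lie_vec_eq_zero {α β : V} (hα : Φ.IsPos α) (hβ : Φ.IsPos β) (h : α + β ∉ Φ.R) :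
    ⁅C.vec α, C.vec β⁆ = 0 := by
  rw [C.lie_vec hα hβ, C.vec_of_not_isPos fun h' => h h'.1, smul_zero]

@[elab_as_elim]
lemma induction_vec {P : L → Prop} (h0 : P 0) (hadd : ∀ x y, P x → P y → P (x + y))
    (hsmul : ∀ (c : ℂ) x, P x → P (c • x)) (hvec : ∀ β, Φ.IsPos β → P (C.vec β)) (x : L) :
    P x := by
  refine Submodule.span_induction (p := fun x _ => P x) ?_ h0 (fun x y _ _ => hadd x y)
    (fun c x _ => hsmul c x) (C.e.mem_span x)
  rintro _ ⟨β, rfl⟩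
  rw [← C.vec_of_isPos β.2]
  exact hvec _ β.2

lemma ext_vec {S T : Module.End ℂ L} (h : ∀ β, Φ.IsPos β → S (C.vec β) = T (C.vec β)) :
    S = T := by
  refine C.e.ext fun β => ?_
  rw [← C.vec_of_isPos β.2]
  exact h _ β.2

lemma isLieDerivation_of_vec {T : Module.End ℂ L}
    (h : ∀ α β, Φ.IsPos α → Φ.IsPos β →
      T ⁅C.vec α, C.vec β⁆ = ⁅T (C.vec α), C.vec β⁆ + ⁅C.vec α, T (C.vec β)⁆) :
    IsLieDerivation T := by
  intro x y
  induction x using C.induction_vec with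
  | h0 => simp
  | hadd x x' hx hx' => simp only [add_lie, map_add, hx, hx']; abel
  | hsmul c x hx => simp only [smul_lie, map_smul, hx, smul_add]
  | hvec α hα =>
    induction y using C.induction_vec with
    | h0 => simp
    | hadd y y' hy hy' => simp only [lie_add, map_add, hy, hy']; abel
    | hsmul c y hy => simp only [lie_smul, map_smul, hy, smul_add]
    | hvec β hβ => exact h α β hα hβ

open Classical in
/-- The projection of `𝔫` onto the root space of `γ`. -/
noncomputable def proj (γ : V) : Module.End ℂ L :=
  C.e.constr ℂ fun δ => if δ.1 = γ then C.e δ else 0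

lemma proj_vec_self (γ : V) : C.proj γ (C.vec γ) = C.vec γ := by
  by_cases h : Φ.IsPos γ
  · simp [C.vec_of_isPos h, proj]
  · simp [C.vec_of_not_isPos h]

lemma proj_vec_ne {γ δ : V} (hne : δ ≠ γ) : C.proj γ (C.vec δ) = 0 := by
  by_cases h : Φ.IsPos δ
  · simp [C.vec_of_isPos h, proj, hne]
  · simp [C.vec_of_not_isPos h]

lemma exists_proj_eq_smul (γ : V) (x : L) : ∃ t : ℂ, C.proj γ x = t • C.vec γ := by
  induction x using C.induction_vec with
  | h0 => exact ⟨0, by simp⟩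
  | hadd x y hx hy =>
    obtain ⟨s, hs⟩ := hx
    obtain ⟨t, ht⟩ := hy
    exact ⟨s + t, by rw [map_add, hs, ht, add_smul]⟩
  | hsmul c x hx =>
    obtain ⟨t, ht⟩ := hx
    exact ⟨c * t, by rw [map_smul, ht, mul_smul]⟩
  | hvec β hβ =>
    rcases eq_or_ne β γ with rfl | h
    · exact ⟨1, by rw [C.proj_vec_self, one_smul]⟩
    · exact ⟨0, by rw [C.proj_vec_ne h, zero_smul]⟩

lemma proj_lie_vec (γ : V) {β : V} (hβ : Φ.IsPos β) (x : L) :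
    C.proj (γ + β) ⁅x, C.vec β⁆ = ⁅C.proj γ x, C.vec β⁆ := by
  induction x using C.induction_vec with
  | h0 => simp
  | hadd x y hx hy => simp only [add_lie, map_add, hx, hy]
  | hsmul c x hx => simp only [smul_lie, map_smul, hx]
  | hvec δ hδ =>
    rcases eq_or_ne δ γ with rfl | h
    · rw [C.lie_vec hδ hβ, map_smul, C.proj_vec_self, C.proj_vec_self, C.lie_vec hδ hβ]
    · rw [C.lie_vec hδ hβ, map_smul, C.proj_vec_ne h, C.proj_vec_ne (by simpa using h)]
      simp

lemma sum_proj (Λ : Finset V) (β : V) (h : ∀ δ, Φ.IsPos δ → δ - β ∈ Λ) (x : L) :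
    ∑ w ∈ Λ, C.proj (β + w) x = x := by
  induction x using C.induction_vec with
  | h0 => simp
  | hadd x y hx hy => simp only [map_add, Finset.sum_add_distrib, hx, hy]
  | hsmul c x hx => simp only [map_smul, ← Finset.smul_sum, hx]
  | hvec δ hδ =>
    rw [Finset.sum_eq_single_of_mem _ (h δ hδ), add_sub_cancel, C.proj_vec_self]
    intro w _ hw
    refine C.proj_vec_ne fun h => hw ?_
    rw [h, add_sub_cancel_left]

/-- The linear map `T` shifts weights by `w`. -/
def HasWeight (T : Module.End ℂ L) (w : V) : Prop :=
  ∀ β, Φ.IsPos β → ∃ t : ℂ, T (C.vec β) = t • C.vec (β + w)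

/-- The component of `T` that shifts weights by `w`. -/
noncomputable def comp (T : Module.End ℂ L) (w : V) : Module.End ℂ L :=
  C.e.constr ℂ fun β => C.proj (β.1 + w) (T (C.e β))

lemma comp_vec (T : Module.End ℂ L) (w : V) {β : V} (hβ : Φ.IsPos β) :
    C.comp T w (C.vec β) = C.proj (β + w) (T (C.vec β)) := by
  simp [comp, C.vec_of_isPos hβ]

lemma hasWeight_comp (T : Module.End ℂ L) (w : V) : C.HasWeight (C.comp T w) w := by
  intro β hβ
  rw [C.comp_vec T w hβ]
  exact C.exists_proj_eq_smul _ _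

lemma isLieDerivation_comp {T : Module.End ℂ L} (hT : IsLieDerivation T) (w : V) :
    IsLieDerivation (C.comp T w) := by
  refine C.isLieDerivation_of_vec fun α β hα hβ => ?_
  have key : C.comp T w ⁅C.vec α, C.vec β⁆ = C.proj (α + β + w) (T ⁅C.vec α, C.vec β⁆) := by
    rw [C.lie_vec hα hβ]
    by_cases h : Φ.IsPos (α + β)
    · simp only [map_smul, C.comp_vec T w h]
    · simp [C.vec_of_not_isPos h]
  rw [key, hT, map_add, C.comp_vec T w hα, C.comp_vec T w hβ, ← C.proj_lie_vec _ hβ,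
    ← lie_skew (C.vec α) (C.proj _ _), ← C.proj_lie_vec _ hα, ← lie_skew (C.vec α) (T _), map_neg,
    add_right_comm α w β, add_right_comm β w α, add_comm β α]

lemma exists_sum_comp (T : Module.End ℂ L) : ∃ Λ : Finset V, T = ∑ w ∈ Λ, C.comp T w := by
  classical
  refine ⟨Finset.image₂ (· - ·) Φ.R Φ.R, C.ext_vec fun β hβ => ?_⟩
  rw [LinearMap.sum_apply, Finset.sum_congr rfl fun w _ => C.comp_vec T w hβ, C.sum_proj]
  exact fun δ hδ => Finset.mem_image₂_of_mem hδ.1 hβ.1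

/-- The simple root vectors generate: a derivation killing all of them vanishes. -/
lemma derivation_ext {S T : Module.End ℂ L} (hS : IsLieDerivation S) (hT : IsLieDerivation T)
    (h : ∀ i, S (C.vec (Φ.simple i)) = T (C.vec (Φ.simple i))) : S = T := by
  refine C.ext_vec fun β hβ => ?_
  refine IsPos.induction (P := fun β => S (C.vec β) = T (C.vec β)) h
    (fun β i hβ hs ih => ?_) hβ
  have hN : C.N β (Φ.simple i) ≠ 0 := C.N_ne_zero ⟨β, hβ⟩ ⟨_, Φ.isPos_simple i⟩ hs
  refine smul_right_injective L hN ?_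
  simp only [← map_smul, ← C.lie_vec hβ (Φ.isPos_simple i), hS _ _, hT _ _, ih, h]

/-! ### Strings through simple root vectors -/

lemma exists_ad_pow_vec (i : Fin n) {β : V} (hβ : Φ.IsPos β) (k : ℕ) :
    ∃ t : ℂ, (ad ℂ L (C.vec (Φ.simple i)) ^ k) (C.vec β) = t • C.vec (β + (k : ℝ) • Φ.simple i) ∧
      ((∀ l < k, Φ.IsPos (β + ((l : ℝ) + 1) • Φ.simple i)) → t ≠ 0) := by
  induction k with
  | zero => exact ⟨1, by simp, by simp⟩
  | succ k ih =>
    obtain ⟨t, ht, ht0⟩ := ih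
    have hv : β + ((k : ℝ) + 1) • Φ.simple i = Φ.simple i + (β + (k : ℝ) • Φ.simple i) := by
      module
    push_cast
    rw [pow_succ', Module.End.mul_apply, ht, map_smul, ad_apply, hv]
    by_cases hk : Φ.IsPos (β + (k : ℝ) • Φ.simple i)
    · refine ⟨t * C.N (Φ.simple i) (β + (k : ℝ) • Φ.simple i), ?_, fun h => ?_⟩
      · rw [C.lie_vec (Φ.isPos_simple i) hk, mul_smul]
      · refine mul_ne_zero (ht0 fun l hl => h l (by omega)) ?_
        exact C.N_ne_zero ⟨_, Φ.isPos_simple i⟩ ⟨_, hk⟩ (hv ▸ h k (by omega))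
    · refine ⟨0, ?_, fun h => absurd ?_ hk⟩
      · rw [C.vec_of_not_isPos hk]; simp
      · rcases k with _ | k
        · simpa using hβ
        · simpa using h k (by omega)

lemma ad_pow_vec_ne_zero {i : Fin n} {β : V} (hβ : Φ.IsPos β) (hne : β ≠ Φ.simple i) {k : ℕ}
    (hk : β + (k : ℝ) • Φ.simple i ∈ Φ.R) :
    (ad ℂ L (C.vec (Φ.simple i)) ^ k) (C.vec β) ≠ 0 := by
  obtain ⟨t, ht, ht0⟩ := C.exists_ad_pow_vec i hβ k
  rw [ht]
  refine smul_ne_zero (ht0 fun l hl => ?_) (C.vec_ne_zero (hβ.string hne hk le_rfl))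
  simpa using hβ.string hne hk (k := l + 1) (by omega)

lemma ad_pow_vec_eq_zero {i : Fin n} {β : V} (hβ : Φ.IsPos β) {k : ℕ}
    (hk : β + (k : ℝ) • Φ.simple i ∉ Φ.R) :
    (ad ℂ L (C.vec (Φ.simple i)) ^ k) (C.vec β) = 0 := by
  obtain ⟨t, ht, -⟩ := C.exists_ad_pow_vec i hβ k
  rw [ht, C.vec_of_not_isPos fun h => hk h.1, smul_zero]

end ChevalleyNilradical

namespace RootSystemBase

variable {n : ℕ} {V : Type*} [NormedAddCommGroup V] [InnerProductSpace ℝ V]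
variable {Φ : RootSystemBase n V}

lemma IsPos.ne_neg {α β : V} (hα : Φ.IsPos α) (hβ : Φ.IsPos β) : α ≠ -β := by
  rintro rfl
  refine hα.ne_zero (Φ.ext_lcoord fun i => le_antisymm ?_ ?_)
  · have := hβ.lcoord_nonneg i
    rw [map_neg, map_zero]
    linarith
  · rw [map_zero]
    exact hα.lcoord_nonneg i

lemma exists_nat_cartan {α β : V} (hα : α ∈ Φ.R) (hβ : β ∈ Φ.R) (h : ⟪β, α⟫_ℝ ≤ 0) :
    ∃ q : ℕ, 2 * ⟪β, α⟫_ℝ = -(q : ℝ) * ⟪α, α⟫_ℝ := by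
  obtain ⟨k, hk, -⟩ := Φ.exists_cartan hα hβ
  have hpos := Φ.inner_self_pos_of_mem hα
  have : (k : ℝ) ≤ 0 := by
    by_contra! h'
    nlinarith
  refine ⟨(-k).toNat, ?_⟩
  have h' : (((-k).toNat : ℤ) : ℝ) = -k := by
    rw [Int.toNat_of_nonneg (by exact_mod_cast neg_nonneg.mpr this)]
    push_cast; rfl
  rw [Int.cast_natCast] at h'
  rw [h', hk, neg_neg]

lemma string_end_not_mem {α β : V} (hα : α ∈ Φ.R) (hsub : β - α ∉ Φ.R) {q : ℕ}
    (hq : 2 * ⟪β, α⟫_ℝ = -(q : ℝ) * ⟪α, α⟫_ℝ) : β + ((q + 1 : ℕ) : ℝ) • α ∉ Φ.R := by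
  intro h
  have := Φ.reflect_mem_of_eq (k := q + 2) hα h (by
    rw [inner_add_left, real_inner_smul_left]
    push_cast
    linear_combination hq)
  refine hsub ?_
  convert this using 1
  push_cast
  module

end RootSystemBase

section Derivation

open LieAlgebra

variable {L : Type*} [LieRing L] [LieAlgebra ℂ L] {T : Module.End ℂ L} {e x y : L} {c : ℂ}

lemma IsLieDerivation.map_ad_pow (hT : IsLieDerivation T) (he : T e = 0) (k : ℕ) (y : L) :
    T ((ad ℂ L e ^ k) y) = (ad ℂ L e ^ k) (T y) := by
  induction k with
  | zero => simp
  | succ k ih =>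
    rw [pow_succ', Module.End.mul_apply, Module.End.mul_apply, ad_apply, ad_apply, hT, he, ih,
      zero_lie, zero_add]

/-- If `(ad e)^(q+1) x = 0` and `(ad e)^(a+1) y = 0`, then the iterates of `ad e` on brackets
of iterates of `x` and `y` are, in top degree, multiples of the single top bracket. -/
lemma exists_ad_pow_lie_eq {q a : ℕ} (hx : (ad ℂ L e ^ (q + 1)) x = 0)
    (hy : (ad ℂ L e ^ (a + 1)) y = 0) (N l k : ℕ) (h : l + k + N = q + a) :
    ∃ r : ℕ, (ad ℂ L e ^ N) ⁅(ad ℂ L e ^ l) x, (ad ℂ L e ^ k) y⁆ =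
      r • ⁅(ad ℂ L e ^ q) x, (ad ℂ L e ^ a) y⁆ ∧ (l ≤ q → k ≤ a → 0 < r) := by
  induction N generalizing l k with
  | zero =>
    rcases lt_trichotomy l q with hl | rfl | hl
    · refine ⟨0, ?_, by omega⟩
      rw [Module.End.pow_map_zero_of_le (show a + 1 ≤ k by omega) hy]
      simp
    · obtain rfl : k = a := by omega
      exact ⟨1, by simp, by simp⟩
    · refine ⟨0, ?_, by omega⟩
      rw [Module.End.pow_map_zero_of_le (show q + 1 ≤ l by omega) hx]
      simp
  | succ N ih =>
    obtain ⟨r, hr, hr0⟩ := ih (l + 1) k (by omega)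
    obtain ⟨s, hs, hs0⟩ := ih l (k + 1) (by omega)
    refine ⟨r + s, ?_, fun hl hk => ?_⟩
    · rw [pow_succ, Module.End.mul_apply, ad_apply, leibniz_lie, map_add, add_smul, ← hr, ← hs,
        pow_succ' _ l, pow_succ' _ k]
      simp only [Module.End.mul_apply, ad_apply]
    · rcases hl.lt_or_eq with hl' | hl'
      · have := hr0 hl' hk
        omega
      · have := hs0 hl (by omega)
        omega

lemma IsLieDerivation.ad_pow_lie_eq_zero (hT : IsLieDerivation T) (hc : c ≠ 0)
    (he : T e = c • x) (hTy : T y = 0) {q a : ℕ} (hx : (ad ℂ L e ^ (q + 1)) x = 0)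
    (hy : (ad ℂ L e ^ (a + 1)) y = 0) : (ad ℂ L e ^ (q + a)) ⁅x, y⁆ = 0 := by
  have hstep : ∀ k N, (ad ℂ L e ^ N) (T ((ad ℂ L e ^ (k + 1)) y)) =
      c • (ad ℂ L e ^ N) ⁅x, (ad ℂ L e ^ k) y⁆ +
        (ad ℂ L e ^ (N + 1)) (T ((ad ℂ L e ^ k) y)) := by
    intro k N
    rw [pow_succ' _ k, Module.End.mul_apply, ad_apply, hT, he, map_add, smul_lie, map_smul,
      pow_succ _ N, Module.End.mul_apply, ad_apply]
  have key : ∀ k N : ℕ, k + N = q + a → ∃ r : ℕ, (ad ℂ L e ^ N) (T ((ad ℂ L e ^ (k + 1)) y)) =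
      c • r • ⁅(ad ℂ L e ^ q) x, (ad ℂ L e ^ a) y⁆ ∧ (k ≤ a → 0 < r) := by
    intro k
    induction k with
    | zero =>
      intro N hN
      obtain ⟨r, hr, hr0⟩ := exists_ad_pow_lie_eq hx hy N 0 0 (by omega)
      refine ⟨r, ?_, fun _ => hr0 (by omega) (by omega)⟩
      rw [hstep, ← hr]
      simp [hTy]
    | succ k ih =>
      intro N hN
      obtain ⟨r, hr, hr0⟩ := exists_ad_pow_lie_eq hx hy N 0 (k + 1) (by omega)
      obtain ⟨s, hs, -⟩ := ih (N + 1) (by omega)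
      refine ⟨r + s, ?_, fun hk => by have := hr0 (by omega) hk; omega⟩
      rw [hstep, hs, add_smul, smul_add, ← hr]
      simp
  obtain ⟨r, hr, hr0⟩ := key a q (by omega)
  obtain ⟨s, hs, -⟩ := exists_ad_pow_lie_eq hx hy (q + a) 0 0 (by omega)
  have hZ : ⁅(ad ℂ L e ^ q) x, (ad ℂ L e ^ a) y⁆ = 0 := by
    rw [hy, map_zero, map_zero, ← Nat.cast_smul_eq_nsmul ℂ] at hr
    simpa [hc, (hr0 le_rfl).ne'] using hr.symm
  simpa [hZ] using hs

lemma IsLieDerivation.lie_ad_sq_eq_zero (hT : IsLieDerivation T) (hc : c ≠ 0)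
    (he : T e = c • x) (hTy : T y = 0) (hxy : ⁅x, y⁆ = 0) (hx : ⁅e, ⁅e, x⁆⁆ = 0)
    (hy : ⁅e, ⁅e, ⁅e, y⁆⁆⁆ = 0) : ⁅x, ⁅e, ⁅e, y⁆⁆⁆ = 0 := by
  have h1 : ⁅e, ⁅e, ⁅x, y⁆⁆⁆ = 0 := by simp [hxy]
  have h2 : T ⁅e, ⁅e, ⁅e, y⁆⁆⁆ = 0 := by simp [hy]
  simp only [leibniz_lie e x, leibniz_lie e ⁅e, x⁆, lie_add, hx, zero_lie, zero_add] at h1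
  simp only [hT _ _, he, hTy, lie_zero, add_zero, lie_smul, smul_lie, hxy, smul_zero,
    leibniz_lie e x, ← smul_add, smul_eq_zero, hc, false_or] at h2
  have h3 : (3 : ℂ) • ⁅x, ⁅e, ⁅e, y⁆⁆⁆ = 0 := by
    linear_combination (norm := module) (2 : ℂ) • h2 - h1
  simpa using h3

end Derivation

namespace ChevalleyNilradical

open LieAlgebra RootSystemBase

variable {n : ℕ} {V : Type*} [NormedAddCommGroup V] [InnerProductSpace ℝ V]
  {Φ : RootSystemBase n V} {L : Type*} [LieRing L] [LieAlgebra ℂ L]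
  (C : ChevalleyNilradical Φ L)

/-! ### Derivations of positive weight -/

lemma false_of_inner_neg {T : Module.End ℂ L} (hT : IsLieDerivation T) {i j : Fin n} (hij : i ≠ j)
    {w : V} (hw : Φ.IsPos w) (hwi : Φ.IsPos (w + Φ.simple i)) {c : ℂ} (hc : c ≠ 0)
    (hi : T (C.vec (Φ.simple i)) = c • C.vec (w + Φ.simple i))
    (hj : T (C.vec (Φ.simple j)) = 0) (hneg : ⟪w, Φ.simple j⟫_ℝ < 0) : False := by
  have hpos := Φ.inner_self_pos_of_mem (Φ.simple_mem j)
  have hij' := Φ.inner_simple_nonpos hij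
  obtain ⟨b, hb⟩ := exists_nat_cartan (Φ.simple_mem j) (Φ.simple_mem i) hij'
  have hwi' : ⟪w + Φ.simple i, Φ.simple j⟫_ℝ ≤ 0 := by
    rw [inner_add_left]
    linarith
  obtain ⟨N, hN⟩ := exists_nat_cartan (Φ.simple_mem j) hwi.1 hwi'
  have hbN : b + 1 ≤ N := by
    have : (b : ℝ) < N := by
      rw [inner_add_left] at hN
      by_contra! h
      nlinarith
    exact_mod_cast this
  have hne : w + Φ.simple i ≠ Φ.simple j := add_ne_simple Φ hw (Φ.isPos_simple i) j
  have hmem : w + Φ.simple i + (N : ℝ) • Φ.simple j ∈ Φ.R := by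
    simpa using Φ.reflect_mem_of_eq (Φ.simple_mem j) hwi.1 hN
  refine C.ad_pow_vec_ne_zero hwi hne (hwi.string hne hmem hbN).1 ?_
  have h0 := C.ad_pow_vec_eq_zero (Φ.isPos_simple i)
    (string_end_not_mem (Φ.simple_mem j) (Φ.simple_sub_simple_not_mem i j) hb)
  have h1 := hT.map_ad_pow hj (b + 1) (C.vec (Φ.simple i))
  rw [h0, map_zero, hi, map_smul] at h1
  exact (smul_eq_zero.mp h1.symm).resolve_left hc

lemma isLieDerivation_sub_smul_ad {T : Module.End ℂ L} (hT : IsLieDerivation T) (s : ℂ) (x : L) :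
    IsLieDerivation (T - s • ad ℂ L x) := by
  intro y z
  simp only [LinearMap.sub_apply, LinearMap.smul_apply, ad_apply, hT y z, leibniz_lie x y z,
    sub_lie, lie_sub, smul_lie, lie_smul, smul_add]
  abel

lemma isLieDerivation_zero : IsLieDerivation (0 : Module.End ℂ L) := (derivations L).zero_mem

lemma eq_zero_of_isPos {T : Module.End ℂ L} (hT : IsLieDerivation T) {w : V}
    (hTw : C.HasWeight T w) (hw : Φ.IsPos w) {j : Fin n} (hwj : Φ.IsPos (w + Φ.simple j))
    (hj : T (C.vec (Φ.simple j)) = 0) : T = 0 := by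
  refine C.derivation_ext hT isLieDerivation_zero fun i => ?_
  rw [LinearMap.zero_apply]
  obtain ⟨c, hc⟩ := hTw _ (Φ.isPos_simple i)
  rw [add_comm] at hc
  by_contra h
  have hwi : Φ.IsPos (w + Φ.simple i) :=
    C.isPos_of_vec_ne_zero fun h' => h (by rw [hc, h', smul_zero])
  have hc0 : c ≠ 0 := by
    rintro rfl
    exact h (by rw [hc, zero_smul])
  have hij : i ≠ j := by
    rintro rfl
    exact h hj
  rcases Φ.inner_neg_or_inner_neg hij hw.1 hwi.1 hwj.1 with hneg | hneg
  · have hNi : C.N w (Φ.simple i) ≠ 0 := C.N_ne_zero ⟨w, hw⟩ ⟨_, Φ.isPos_simple i⟩ hwi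
    have hNj : C.N w (Φ.simple j) ≠ 0 := C.N_ne_zero ⟨w, hw⟩ ⟨_, Φ.isPos_simple j⟩ hwj
    refine C.false_of_inner_neg
      (isLieDerivation_sub_smul_ad hT (c / C.N w (Φ.simple i)) (C.vec w)) hij.symm hw hwj
      (c := -(c / C.N w (Φ.simple i) * C.N w (Φ.simple j))) ?_ ?_ ?_ hneg
    · exact neg_ne_zero.mpr (mul_ne_zero (div_ne_zero hc0 hNi) hNj)
    · simp [hj, C.lie_vec hw (Φ.isPos_simple j), mul_smul]
    · simp [hc, C.lie_vec hw (Φ.isPos_simple i), smul_smul, hNi]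
  · exact C.false_of_inner_neg hT hij hw hwi hc0 hc hj hneg

/-- A derivation whose weight is a positive root is inner. -/
lemma exists_eq_smul_ad {T : Module.End ℂ L} (hT : IsLieDerivation T) {w : V}
    (hTw : C.HasWeight T w) (hw : Φ.IsPos w) : ∃ s : ℂ, T = s • ad ℂ L (C.vec w) := by
  by_cases h : ∃ j, Φ.IsPos (w + Φ.simple j)
  · obtain ⟨j, hwj⟩ := h
    have hNj : C.N w (Φ.simple j) ≠ 0 := C.N_ne_zero ⟨w, hw⟩ ⟨_, Φ.isPos_simple j⟩ hwj
    obtain ⟨c, hc⟩ := hTw _ (Φ.isPos_simple j)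
    rw [add_comm] at hc
    refine ⟨c / C.N w (Φ.simple j), sub_eq_zero.mp ?_⟩
    refine C.eq_zero_of_isPos (isLieDerivation_sub_smul_ad hT _ _) ?_ hw hwj ?_
    · intro β hβ
      obtain ⟨t, ht⟩ := hTw β hβ
      refine ⟨t - c / C.N w (Φ.simple j) * C.N w β, ?_⟩
      simp [ht, C.lie_vec hw hβ, sub_smul, mul_smul, add_comm w β]
    · simp [hc, C.lie_vec hw (Φ.isPos_simple j), smul_smul, hNj]
  · refine ⟨0, ?_⟩
    rw [zero_smul]
    refine C.derivation_ext hT isLieDerivation_zero fun i => ?_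
    obtain ⟨c, hc⟩ := hTw _ (Φ.isPos_simple i)
    rw [hc, add_comm, C.vec_of_not_isPos fun h' => h ⟨i, h'⟩, smul_zero, LinearMap.zero_apply]

/-! ### Derivations whose weight is not a root -/

lemma add_simple_not_mem {T : Module.End ℂ L} (hT : IsLieDerivation T) {w : V}
    (hTw : C.HasWeight T w) {i j : Fin n} (hji : j ≠ i) {β : V} (hβw : β = w + Φ.simple i)
    (hβ : Φ.IsPos β) (hw : w ∉ Φ.R) (hw0 : w ≠ 0) {c : ℂ} (hc : c ≠ 0)
    (hi : T (C.vec (Φ.simple i)) = c • C.vec β) (hj : T (C.vec (Φ.simple j)) = 0) {q : ℕ}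
    (hq : 2 * ⟪β, Φ.simple i⟫_ℝ = -(q : ℝ) * ⟪Φ.simple i, Φ.simple i⟫_ℝ) :
    β + (q : ℝ) • Φ.simple i + Φ.simple j ∉ Φ.R := by
  intro hmem
  have hβi : β ≠ Φ.simple i := fun h => hw0 (by simpa [h] using hβw.symm)
  obtain ⟨a, ha⟩ := exists_nat_cartan (Φ.simple_mem i) (Φ.simple_mem j)
    (Φ.inner_simple_nonpos hji)
  have hx := C.ad_pow_vec_eq_zero hβ
    (string_end_not_mem (Φ.simple_mem i) (by simpa [hβw] using hw) hq)
  have hα'' := string_end_not_mem (Φ.simple_mem i) (Φ.simple_sub_simple_not_mem j i) ha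
  have hy := C.ad_pow_vec_eq_zero (Φ.isPos_simple j) hα''
  have hα' : Φ.IsPos (Φ.simple j + (a : ℝ) • Φ.simple i) := by
    simpa using (Φ.isPos_simple j).reflect (Φ.simple_ne hji) ha
  have hθ : β + (Φ.simple j + (a : ℝ) • Φ.simple i) ∈ Φ.R := by
    have := Φ.reflect_mem_of_eq (k := q - a) (Φ.simple_mem i) hmem (by
      simp only [inner_add_left, real_inner_smul_left]
      linear_combination hq + ha)
    convert this using 1
    module
  have hθi := Φ.add_ne_simple hβ hα' i
  have hji' := Φ.isPos_simple j
  by_cases hβj : β + Φ.simple j ∈ Φ.R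
  · have h0 := hT.ad_pow_lie_eq_zero hc hi hj hx hy
    have hpos := hβ.add hji' hβj
    rw [C.lie_vec hβ hji', map_smul] at h0
    refine C.ad_pow_vec_ne_zero hpos (Φ.add_ne_simple hβ hji' i) (k := q + a) ?_
      ((smul_eq_zero.mp h0).resolve_left (C.N_ne_zero ⟨β, hβ⟩ ⟨_, hji'⟩ hpos))
    have := Φ.reflect_mem_of_eq (k := -((q : ℝ) + a)) (Φ.simple_mem i) hβj (by
      simp only [inner_add_left]
      linear_combination hq + ha)
    convert this using 1
    push_cast
    module
  · have hinner : 0 ≤ ⟪β, Φ.simple j⟫_ℝ := by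
      by_contra! h
      exact hβj (Φ.add_mem_of_inner_neg (Φ.simple_mem j) hβ.1 (hβ.ne_neg hji') h)
    have hq1 : 1 ≤ q := by
      by_contra! h
      obtain rfl : q = 0 := by omega
      exact hβj (by simpa using hmem)
    have hbr := C.lie_vec_ne_zero hβ hα' hθ
    have hz : Φ.IsPos (Φ.simple j + (a : ℝ) • Φ.simple i + w) := by
      by_contra h
      obtain ⟨t, ht⟩ := hTw _ hα'
      rw [C.vec_of_not_isPos h, smul_zero] at ht
      have h0 := C.lie_vec_eq_zero (Φ.isPos_simple i) hα' (by
        convert hα'' using 2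
        push_cast
        module)
      have h1 := hT (C.vec (Φ.simple i)) (C.vec (Φ.simple j + (a : ℝ) • Φ.simple i))
      rw [h0, ht, hi, map_zero, lie_zero, add_zero, smul_lie] at h1
      exact hbr ((smul_eq_zero.mp h1.symm).resolve_left hc)
    have hz' : Φ.simple j + (a : ℝ) • Φ.simple i + w =
        β + Φ.simple j + ((a : ℝ) - 1) • Φ.simple i := by
      rw [hβw]
      module
    rw [hz'] at hz
    have ha2 : 2 ≤ a := by
      by_contra! h
      interval_cases a
      · exact hβj (by simpa using hθ)
      · exact hβj (by simpa using hz.1)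
    rw [← add_assoc] at hθ hθi
    obtain ⟨rfl, rfl⟩ := Φ.cartan_eq_two_one (Φ.simple_mem i) (Φ.simple_mem j) hβ.1
      (hji'.ne_neg (Φ.isPos_simple i)) (hβ.ne_neg (Φ.isPos_simple i)) ha2 hq1 ha hq hinner
      hz.1 (hz.ne_neg (Φ.isPos_simple i)) hθ hθi
    have h0 := hT.lie_ad_sq_eq_zero hc hi hj (C.lie_vec_eq_zero hβ hji' hβj)
      (by simpa [pow_succ] using hx) (by simpa [pow_succ] using hy)
    obtain ⟨t, ht, -⟩ := C.exists_ad_pow_vec i hji' 2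
    have ht0 := C.ad_pow_vec_ne_zero hji' (Φ.simple_ne hji) hα'.1
    rw [show ⁅C.vec (Φ.simple i), ⁅C.vec (Φ.simple i), C.vec (Φ.simple j)⁆⁆ =
      (ad ℂ L (C.vec (Φ.simple i)) ^ 2) (C.vec (Φ.simple j)) by simp [pow_succ], ht,
      lie_smul] at h0
    refine (smul_eq_zero.mp h0).elim (fun h => ht0 ?_) hbr
    rw [ht, h, zero_smul]

end ChevalleyNilradical

namespace ChevalleyNilradical

open LieAlgebra RootSystemBase

variable {n : ℕ} {V : Type*} [NormedAddCommGroup V] [InnerProductSpace ℝ V]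
  {Φ : RootSystemBase n V} {L : Type*} [LieRing L] [LieAlgebra ℂ L]
  (C : ChevalleyNilradical Φ L)

/-! ### The derivations `Dᵢ` and `Bᵢ` -/

lemma D_vec (i : Fin n) {β : V} (hβ : Φ.IsPos β) :
    C.D i (C.vec β) = (Φ.coord β i : ℂ) • C.vec β := by
  simp [D, C.vec_of_isPos hβ]

lemma D_vec_simple (i j : Fin n) :
    C.D i (C.vec (Φ.simple j)) = (if i = j then (1 : ℂ) else 0) • C.vec (Φ.simple j) := by
  rw [C.D_vec i (Φ.isPos_simple j), Φ.coord_simple]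
  push_cast
  rfl

lemma isLieDerivation_D (i : Fin n) : IsLieDerivation (C.D i) := by
  refine C.isLieDerivation_of_vec fun α β hα hβ => ?_
  rw [C.D_vec i hα, C.D_vec i hβ, smul_lie, lie_smul, ← add_smul]
  by_cases h : α + β ∈ Φ.R
  · rw [C.lie_vec hα hβ, map_smul, C.D_vec i (hα.add hβ h), Φ.coord_add hα.1 hβ.1 h]
    push_cast
    rw [smul_comm]
  · rw [C.lie_vec_eq_zero hα hβ h, map_zero, smul_zero]

section Highest

variable {μ : V} (hμ : Φ.IsHighest μ) {m : Fin n → ℕ}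
  (hm : ∀ i, (∀ k : ℕ, k ≤ m i → Φ.IsPos (μ - k • Φ.simple i)) ∧
    ¬ Φ.IsPos (μ - (m i + 1) • Φ.simple i))
  (hγ : ∀ i, Φ.IsPos (μ - m i • Φ.simple i)) (hrank : 2 ≤ n)

lemma B_vec_self (i : Fin n) :
    C.B μ m hγ i (C.vec (Φ.simple i)) = C.vec (μ - m i • Φ.simple i) := by
  simp [B, C.vec_of_isPos (Φ.isPos_simple i), C.vec_of_isPos (hγ i)]

lemma B_vec_ne (i : Fin n) {β : V} (h : β ≠ Φ.simple i) : C.B μ m hγ i (C.vec β) = 0 := by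
  by_cases hβ : Φ.IsPos β
  · simp [B, C.vec_of_isPos hβ, h]
  · simp [C.vec_of_not_isPos hβ]

lemma B_vec_simple (i j : Fin n) : C.B μ m hγ i (C.vec (Φ.simple j)) =
    (if i = j then (1 : ℂ) else 0) • C.vec (μ - m j • Φ.simple j) := by
  rcases eq_or_ne i j with rfl | h
  · rw [C.B_vec_self, if_pos rfl, one_smul]
  · rw [C.B_vec_ne hγ i (Φ.simple_ne h.symm), if_neg h, zero_smul]

include hμ hm hrank in
lemma sub_add_not_mem (i : Fin n) {β : V}
    (hβ : Φ.IsPos β) (hne : β ≠ Φ.simple i) : μ - m i • Φ.simple i + β ∉ Φ.R := by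
  intro h
  obtain ⟨k, hk, -⟩ := Φ.exists_cartan (Φ.simple_mem i) hβ.1
  have hμi := hμ.cartan_eq hrank i (hm i).1 (hm i).2
  rw [← Nat.cast_smul_eq_nsmul ℝ] at h
  have := Φ.reflect_mem_of_eq (k := k - m i) (Φ.simple_mem i) h (by
    simp only [inner_add_left, inner_sub_left, real_inner_smul_left]
    linear_combination hμi + hk)
  refine hμ.add_not_mem (hβ.reflect hne hk) ?_
  convert this using 1
  module

include hμ hm hrank in
lemma isLieDerivation_B (i : Fin n) : IsLieDerivation (C.B μ m hγ i) := by
  refine C.isLieDerivation_of_vec fun α β hα hβ => ?_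
  rw [C.lie_vec hα hβ, map_smul, C.B_vec_ne hγ i (Φ.add_ne_simple hα hβ i), smul_zero]
  rcases eq_or_ne α (Φ.simple i) with rfl | hαi <;> rcases eq_or_ne β (Φ.simple i) with rfl | hβi
  · rw [← lie_skew, neg_add_cancel]
  · rw [C.B_vec_self, C.B_vec_ne hγ i hβi, lie_zero, add_zero,
      C.lie_vec_eq_zero (hγ i) hβ (sub_add_not_mem hμ hm hrank i hβ hβi)]
  · rw [C.B_vec_self, C.B_vec_ne hγ i hαi, zero_lie, zero_add, ← lie_skew,
      C.lie_vec_eq_zero (hγ i) hα (sub_add_not_mem hμ hm hrank i hα hαi), neg_zero]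
  · rw [C.B_vec_ne hγ i hαi, C.B_vec_ne hγ i hβi, zero_lie, lie_zero, add_zero]

include C hμ in
lemma eq_highest {ν : V} (hν : Φ.IsPos ν) (h : ∀ i, ν + Φ.simple i ∉ Φ.R) : ν = μ := by
  by_contra hne
  have hi : ∀ i, 0 ≤ ⟪ν, Φ.simple i⟫_ℝ := by
    intro i
    by_contra! hi
    exact h i (Φ.add_mem_of_inner_neg (Φ.simple_mem i) hν.1 (hν.ne_neg (Φ.isPos_simple i)) hi)
  have hsum : ∀ v, ⟪ν, v⟫_ℝ = ∑ i, Φ.lcoord i v * ⟪ν, Φ.simple i⟫_ℝ := by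
    intro v
    conv_lhs => rw [← Φ.sum_lcoord v]
    simp only [inner_sum, real_inner_smul_right]
  have hle : ⟪ν, ν⟫_ℝ ≤ ⟪ν, μ⟫_ℝ := by
    rw [hsum ν, hsum μ]
    exact Finset.sum_le_sum fun i _ => mul_le_mul_of_nonneg_right (hμ.lcoord_le hν i) (hi i)
  have hκ : μ - ν ∈ Φ.R := by
    refine Φ.sub_mem_of_inner_pos hν.1 hμ.1.1 (Ne.symm hne) ?_
    rw [real_inner_comm]
    exact (Φ.inner_self_pos_of_mem hν.1).trans_le hle
  have hκ' : Φ.IsPos (μ - ν) := by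
    refine Φ.isPos_iff.mpr ⟨hκ, fun i => ?_⟩
    rw [map_sub]
    exact sub_nonneg.mpr (hμ.lcoord_le hν i)
  have had : ad ℂ L (C.vec ν) = 0 := by
    refine C.derivation_ext (fun x y => leibniz_lie _ x y) isLieDerivation_zero fun i => ?_
    exact C.lie_vec_eq_zero hν (Φ.isPos_simple i) (h i)
  refine C.lie_vec_ne_zero hν hκ' (by simpa using hμ.1.1) ?_
  rw [← ad_apply ℂ, had, LinearMap.zero_apply]

include hμ hm hrank in
/-- A derivation whose weight is nonzero and not a positive root is a multiple of some `Bᵢ`. -/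
lemma exists_eq_smul_B {T : Module.End ℂ L} (hT : IsLieDerivation T) {w : V}
    (hTw : C.HasWeight T w) (hw : ¬ Φ.IsPos w) (hw0 : w ≠ 0) :
    T = 0 ∨ ∃ (i : Fin n) (c : ℂ), T = c • C.B μ m hγ i := by
  by_cases h : ∀ i, T (C.vec (Φ.simple i)) = 0
  · exact .inl (C.derivation_ext hT isLieDerivation_zero h)
  push Not at h
  obtain ⟨i, hi⟩ := h
  obtain ⟨c, hc⟩ := hTw _ (Φ.isPos_simple i)
  rw [add_comm] at hc
  have hβ : Φ.IsPos (w + Φ.simple i) :=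
    C.isPos_of_vec_ne_zero fun h' => hi (by rw [hc, h', smul_zero])
  have hc0 : c ≠ 0 := by
    rintro rfl
    exact hi (by rw [hc, zero_smul])
  have hwR := Φ.not_mem_of_not_isPos hw hβ
  have hj : ∀ j, j ≠ i → T (C.vec (Φ.simple j)) = 0 := by
    intro j hji
    obtain ⟨d, hd⟩ := hTw _ (Φ.isPos_simple j)
    rw [hd, add_comm, C.vec_of_not_isPos (Φ.not_isPos_add_simple hji.symm hwR hw0 hβ), smul_zero]
  have hsub : w + Φ.simple i - Φ.simple i ∉ Φ.R := by rwa [add_sub_cancel_right]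
  obtain ⟨q, hq⟩ := exists_nat_cartan (Φ.simple_mem i) hβ.1
    (Φ.inner_nonpos_of_not_mem (Φ.simple_mem i) hβ.1 hsub (by rwa [add_sub_cancel_right]))
  have hν : Φ.IsPos (w + Φ.simple i + (q : ℝ) • Φ.simple i) := by
    simpa using hβ.reflect (fun h => hw0 (by simpa using h)) hq
  have hνμ : w + Φ.simple i + (q : ℝ) • Φ.simple i = μ := by
    refine C.eq_highest hμ hν fun j => ?_
    rcases eq_or_ne j i with rfl | hji
    · convert string_end_not_mem (Φ.simple_mem j) hsub hq using 2
      push_cast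
      module
    · exact C.add_simple_not_mem hT hTw hji rfl hβ hwR hw0 hc0 hc (hj j hji) hq
  have hqm : q = m i := by
    have hμi := hμ.cartan_eq hrank i (hm i).1 (hm i).2
    rw [← hνμ, inner_add_left, real_inner_smul_left] at hμi
    have := mul_right_cancel₀ (Φ.inner_self_pos_of_mem (Φ.simple_mem i)).ne'
      (show (q : ℝ) * ⟪Φ.simple i, Φ.simple i⟫_ℝ = m i * ⟪Φ.simple i, Φ.simple i⟫_ℝ by
        linear_combination hμi - hq)
    exact_mod_cast this
  refine .inr ⟨i, c, C.derivation_ext hT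
    ((derivations L).smul_mem c (C.isLieDerivation_B hμ hm hγ hrank i)) fun j => ?_⟩
  rw [LinearMap.smul_apply]
  rcases eq_or_ne j i with rfl | hji
  · rw [C.B_vec_self, hc, ← hνμ, ← hqm, ← Nat.cast_smul_eq_nsmul ℝ, add_sub_cancel_right]
  · rw [hj j hji, C.B_vec_ne hγ i (Φ.simple_ne hji), smul_zero]

end Highest

lemma exists_eq_sum_D {T : Module.End ℂ L} (hT : IsLieDerivation T) (hT0 : C.HasWeight T 0) :
    ∃ c : Fin n → ℂ, T = ∑ i, c i • C.D i := by
  choose c hc using fun i => hT0 _ (Φ.isPos_simple i)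
  refine ⟨c, C.derivation_ext hT ?_ fun j => ?_⟩
  · exact (derivations L).sum_mem fun i _ =>
      (derivations L).smul_mem _ (C.isLieDerivation_D i)
  · simp [hc, C.D_vec_simple]

/-! ### The cohomology classes -/

section Highest

variable {μ : V} (hμ : Φ.IsHighest μ) {m : Fin n → ℕ}
  (hm : ∀ i, (∀ k : ℕ, k ≤ m i → Φ.IsPos (μ - k • Φ.simple i)) ∧
    ¬ Φ.IsPos (μ - (m i + 1) • Φ.simple i))
  (hγ : ∀ i, Φ.IsPos (μ - m i • Φ.simple i)) (hrank : 2 ≤ n)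

include hμ hm hrank in
lemma mk_mem_span {T : Module.End ℂ L} (hT : IsLieDerivation T) :
    (Submodule.Quotient.mk T : Module.End ℂ L ⧸ innerDerivations L) ∈
      Submodule.span ℂ (Set.range fun j : Fin n ⊕ Fin n =>
        (Submodule.Quotient.mk (Sum.elim C.D (C.B μ m hγ) j) :
          Module.End ℂ L ⧸ innerDerivations L)) := by
  set S := Submodule.span ℂ (Set.range fun j : Fin n ⊕ Fin n =>
    (Submodule.Quotient.mk (Sum.elim C.D (C.B μ m hγ) j) :
      Module.End ℂ L ⧸ innerDerivations L))
  change T ∈ S.comap (innerDerivations L).mkQ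
  obtain ⟨Λ, hΛ⟩ := C.exists_sum_comp T
  rw [hΛ]
  refine Submodule.sum_mem _ fun w _ => ?_
  have hder := C.isLieDerivation_comp hT w
  have hwt := C.hasWeight_comp T w
  rcases eq_or_ne w 0 with rfl | hw0
  · obtain ⟨c, hc⟩ := C.exists_eq_sum_D hder hwt
    rw [hc]
    exact Submodule.sum_mem _ fun i _ => Submodule.smul_mem _ _
      (Submodule.subset_span ⟨.inl i, rfl⟩)
  · by_cases hw : Φ.IsPos w
    · obtain ⟨s, hs⟩ := C.exists_eq_smul_ad hder hwt hw
      rw [hs]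
      refine Submodule.smul_mem _ _ ?_
      rw [Submodule.mem_comap, Submodule.mkQ_apply, (Submodule.Quotient.mk_eq_zero _).mpr]
      · exact S.zero_mem
      · exact ⟨C.vec w, rfl⟩
    · rcases C.exists_eq_smul_B hμ hm hγ hrank hder hwt hw hw0 with h | ⟨i, c, h⟩
      · rw [h]
        exact Submodule.zero_mem _
      · rw [h]
        exact Submodule.smul_mem _ _ (Submodule.subset_span ⟨.inr i, rfl⟩)

lemma proj_lie_eq_zero {γ β : V} (hβ : Φ.IsPos β) (h : ¬ Φ.IsPos (γ - β)) (x : L) :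
    C.proj γ ⁅x, C.vec β⁆ = 0 := by
  obtain ⟨t, ht⟩ := C.exists_proj_eq_smul (γ - β) x
  rw [← sub_add_cancel γ β, C.proj_lie_vec _ hβ, ht, C.vec_of_not_isPos h, smul_zero, zero_lie]

include hμ hrank in
lemma sub_nsmul_ne_simple (j : Fin n) (k : ℕ) : μ - k • Φ.simple j ≠ Φ.simple j := by
  obtain ⟨i, hij, hi⟩ := hμ.1.exists_lcoord_pos (hμ.ne_simple hrank j)
  intro h
  refine Φ.ne_smul_simple hij hi (k + 1) ?_
  rw [sub_eq_iff_eq_add.mp h, ← Nat.cast_smul_eq_nsmul ℝ]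
  module

include hμ hm hrank in
lemma linearIndependent_mk : LinearIndependent ℂ (fun j : Fin n ⊕ Fin n =>
    (Submodule.Quotient.mk (Sum.elim C.D (C.B μ m hγ) j) :
      Module.End ℂ L ⧸ innerDerivations L)) := by
  rw [Fintype.linearIndependent_iff]
  intro g hg
  have hmem : ∑ j, g j • Sum.elim C.D (C.B μ m hγ) j ∈ innerDerivations L := by
    rw [← Submodule.Quotient.mk_eq_zero, ← Submodule.mkQ_apply, map_sum, ← hg]
    simp only [map_smul, Submodule.mkQ_apply]
  obtain ⟨x, hx⟩ := hmem
  have key : ∀ j, ⁅x, C.vec (Φ.simple j)⁆ = g (.inl j) • C.vec (Φ.simple j) +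
      g (.inr j) • C.vec (μ - m j • Φ.simple j) := by
    intro j
    have := LinearMap.congr_fun hx (C.vec (Φ.simple j))
    simpa [C.D_vec_simple, C.B_vec_simple] using this
  have hne := sub_nsmul_ne_simple hμ hrank
  rintro (j | j)
  · have h := congrArg (C.proj (Φ.simple j)) (key j)
    rw [C.proj_lie_eq_zero (Φ.isPos_simple j) (fun h => h.ne_zero (sub_self _)), map_add, map_smul,
      map_smul, C.proj_vec_self, C.proj_vec_ne (hne j _), smul_zero, add_zero] at h
    exact (smul_eq_zero.mp h.symm).resolve_right (C.vec_ne_zero (Φ.isPos_simple j))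
  · have h := congrArg (C.proj (μ - m j • Φ.simple j)) (key j)
    rw [C.proj_lie_eq_zero (Φ.isPos_simple j) (by
        rw [sub_sub, ← succ_nsmul]
        exact (hm j).2), map_add, map_smul,
      map_smul, C.proj_vec_self, C.proj_vec_ne (hne j _).symm, smul_zero, zero_add] at h
    exact (smul_eq_zero.mp h.symm).resolve_right (C.vec_ne_zero (hγ j))

include C hμ hm hγ hrank in
lemma finrank_derivations_quotient : Module.finrank ℂ
    (↥(derivations L) ⧸
      Submodule.comap (derivations L).subtype (innerDerivations L)) = 2 * n := by
  let f := (innerDerivations L).mkQ ∘ₗ (derivations L).subtype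
  have hker : Submodule.comap (derivations L).subtype (innerDerivations L) = LinearMap.ker f := by
    rw [LinearMap.ker_comp, Submodule.ker_mkQ]
  have hrange : LinearMap.range f = Submodule.span ℂ (Set.range fun j : Fin n ⊕ Fin n =>
      (Submodule.Quotient.mk (Sum.elim C.D (C.B μ m hγ) j) :
        Module.End ℂ L ⧸ innerDerivations L)) := by
    apply le_antisymm
    · rintro _ ⟨T, rfl⟩
      exact C.mk_mem_span hμ hm hγ hrank T.2
    · rw [Submodule.span_le]
      rintro _ ⟨i | i, rfl⟩
      · exact ⟨⟨_, C.isLieDerivation_D i⟩, rfl⟩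
      · exact ⟨⟨_, C.isLieDerivation_B hμ hm hγ hrank i⟩, rfl⟩
  rw [((Submodule.quotEquivOfEq _ _ hker).trans f.quotKerEquivRange).finrank_eq, hrange,
    finrank_span_eq_card (C.linearIndependent_mk hμ hm hγ hrank), Fintype.card_sum,
    Fintype.card_fin, two_mul]

end Highest

end ChevalleyNilradical

/-- If `𝔤 ≠ 𝔰𝔩(2)` (equivalently, the rank `n` is at least `2`), then the
first adjoint cohomology `H¹(𝔫;𝔫) = Der(𝔫)/ad(𝔫)` has dimension `2n`, and the classes
of the derivations `D₁, …, Dₙ, B₁, …, Bₙ` form a basis of it. -/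
theorem H1_dim_eq_two_rank
    {n : ℕ} {V : Type*} [NormedAddCommGroup V] [InnerProductSpace ℝ V]
    (Φ : RootSystemBase n V) (L : Type*) [LieRing L] [LieAlgebra ℂ L]
    (C : ChevalleyNilradical Φ L) (μ : V) (hμ : Φ.IsHighest μ) (m : Fin n → ℕ)
    (hm : ∀ i, (∀ k : ℕ, k ≤ m i → Φ.IsPos (μ - k • Φ.simple i)) ∧
      ¬ Φ.IsPos (μ - (m i + 1) • Φ.simple i))
    (hγ : ∀ i, Φ.IsPos (μ - m i • Φ.simple i))
    (hrank : 2 ≤ n) :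
    -- `dim H¹(𝔫;𝔫) = 2n`
    Module.finrank ℂ
      (↥(derivations L) ⧸
        Submodule.comap (derivations L).subtype (innerDerivations L)) = 2 * n ∧
    -- the classes of `D₁, …, Dₙ, B₁, …, Bₙ` are linearly independent mod inner
    -- derivations …
    LinearIndependent ℂ (fun j : Fin n ⊕ Fin n =>
      (Submodule.Quotient.mk (Sum.elim C.D (C.B μ m hγ) j) :
        Module.End ℂ L ⧸ innerDerivations L)) ∧
    -- … and they span `Der(𝔫)` modulo the inner derivations
    (∀ T : Module.End ℂ L, IsLieDerivation T →
      (Submodule.Quotient.mk T : Module.End ℂ L ⧸ innerDerivations L) ∈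
        Submodule.span ℂ (Set.range fun j : Fin n ⊕ Fin n =>
          (Submodule.Quotient.mk (Sum.elim C.D (C.B μ m hγ) j) :
            Module.End ℂ L ⧸ innerDerivations L))) := by
  exact ⟨C.finrank_derivations_quotient hμ hm hγ hrank, C.linearIndependent_mk hμ hm hγ hrank,
    fun _ hT => C.mk_mem_span hμ hm hγ hrank hT⟩
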